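/- Let (R, m) be a Noetherian local ring, M a finitely generated R-module, and p ∈ Supp_R(M) with ht_M(p) ≥ 3 and p not contained in the set of zerodivisors of M. If M admits a canonical module and p is an attached prime of H_m^{dim M - 1}(M), then grade(p·R̂, ω_{M̂}) = 2, where ω_{M̂} is the canonical module of the completion of M. -/

import Mathlib

open CategoryTheory IsLocalRing Pointwise

noncomputable section

/-- `E` is an injective hull of `S ⧸ J` over `S`. -/
def IsInjHull (S : Type) [CommRing S] (J : Ideal S) (E : Type) [AddCommGroup E]
    [Module S E] : Prop :=
  Module.Injective S E ∧
    ∃ f : (S ⧸ J) →ₗ[S] E, Function.Injective f ∧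
      ∀ N : Submodule S E, N ≠ ⊥ → N ⊓ LinearMap.range f ≠ ⊥

/-- Local cohomology `H^i_J(M)`. -/
abbrev LC (S : Type) [CommRing S] (J : Ideal S) (i : ℕ) (M : ModuleCat S) : ModuleCat S :=
  (localCohomology J i).obj M

/-- Krull dimension of a module (dimension of its support). -/
def mdim (S : Type) [CommRing S] (M : Type) [AddCommGroup M] [Module S M] : WithBot ℕ∞ :=
  Order.krullDim (Module.support S M)

/-- Depth/grade of an ideal `J` on `M`: supremum of lengths of `M`-regular sequences in `J`. -/
def gradeI (S : Type) [CommRing S] (J : Ideal S) (M : Type) [AddCommGroup M]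
    [Module S M] : ℕ∞ :=
  sSup {n : ℕ∞ | ∃ rs : List S, (rs.length : ℕ∞) = n ∧ (∀ r ∈ rs, r ∈ J) ∧
    RingTheory.Sequence.IsRegular M rs}

/-- The local "height" of `M` at a prime `p`, i.e. `dim_{S_p} M_p`. -/
def htM (S : Type) [CommRing S] (M : Type) [AddCommGroup M] [Module S M]
    (p : PrimeSpectrum S) : WithBot ℕ∞ :=
  mdim (Localization.AtPrime p.asIdeal) (LocalizedModule p.asIdeal.primeCompl M)

/-- `ht_M(a) = inf { dim_{S_p} M_p : p ⊇ a, p ∈ Supp M }`. -/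
def htI (S : Type) [CommRing S] (M : Type) [AddCommGroup M] [Module S M]
    (a : Ideal S) : WithBot ℕ∞ :=
  sInf {d | ∃ p ∈ Module.support S M, a ≤ p.asIdeal ∧ d = htM S M p}

/-- Serre's condition `S_n` for the module `M`. -/
def Serre (S : Type) [CommRing S] (n : ℕ) (M : Type) [AddCommGroup M] [Module S M] : Prop :=
  ∀ (p : Ideal S) [p.IsPrime],
    min (n : WithBot ℕ∞)
        (mdim (Localization.AtPrime p) (LocalizedModule p.primeCompl M)) ≤
      (gradeI (Localization.AtPrime p) (IsLocalRing.maximalIdeal (Localization.AtPrime p))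
        (LocalizedModule p.primeCompl M) : ℕ∞)

/-- Attached primes of `M` (Macdonald): primes of the form `Ann(M ⧸ N)`. -/
def attachedPrimes (S : Type) [CommRing S] (M : Type) [AddCommGroup M] [Module S M] :
    Set (Ideal S) :=
  {p | p.IsPrime ∧ ∃ N : Submodule S M, p = Module.annihilator S (M ⧸ N)}

/-- `ω` is a canonical module of the `d`-dimensional module `M` over `(S, J)`:
its "Matlis dual" `Hom_S(ω, E)` is isomorphic to `H^d_J(M)`. -/
def IsCanonicalModule (S : Type) [CommRing S] (J : Ideal S) (d : ℕ)
    (M ω : ModuleCat S) : Prop :=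
  Module.Finite S ω ∧ ∃ E : ModuleCat S, IsInjHull S J ↥E ∧
    Nonempty ((↥ω →ₗ[S] ↥E) ≃ₗ[S] ↥(LC S J d M))

/-- `(S, J)` is quasi-Gorenstein: `H^d_J(S)` is an injective hull of `S ⧸ J`, `d = dim S`. -/
def IsQuasiGorensteinAt (S : Type) [CommRing S] (J : Ideal S) : Prop :=
  ∃ d : ℕ, ringKrullDim S = (d : WithBot ℕ∞) ∧
    ∃ E : ModuleCat S, IsInjHull S J ↥E ∧
      Nonempty (↥(LC S J d (ModuleCat.of S S)) ≃ₗ[S] ↥E)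

/-- Totally reflexive modules. -/
def TotallyReflexive (S : Type) [CommRing S] (M : ModuleCat S) : Prop :=
  Module.Finite S ↥M ∧ Module.IsReflexive S ↥M ∧
    ∀ i : ℕ, 0 < i →
      Subsingleton ↥(((Ext S (ModuleCat S) i).obj (Opposite.op M)).obj (ModuleCat.of S S)) ∧
      Subsingleton ↥(((Ext S (ModuleCat S) i).obj
        (Opposite.op (ModuleCat.of S (Module.Dual S ↥M)))).obj (ModuleCat.of S S))

/-- `G`-dimension at most `n`. -/
def GdimLE (S : Type) [CommRing S] : ℕ → ModuleCat S → Prop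
  | 0, M => TotallyReflexive S M
  | n + 1, M => ∃ (G : ModuleCat S) (f : ↥G →ₗ[S] ↥M), Function.Surjective f ∧
      TotallyReflexive S G ∧ GdimLE S n (ModuleCat.of S (LinearMap.ker f))

/-- Injective dimension at most `n`. -/
def InjDimLE (S : Type) [CommRing S] : ℕ → ModuleCat S → Prop
  | 0, M => Module.Injective S ↥M
  | n + 1, M => ∃ (E : ModuleCat S) (f : ↥M →ₗ[S] ↥E), Function.Injective f ∧
      Module.Injective S ↥E ∧ InjDimLE S n (ModuleCat.of S (↥E ⧸ LinearMap.range f))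

/-- Injective dimension, as an element of `ℕ∞`. -/
def injDim (S : Type) [CommRing S] (M : ModuleCat S) : ℕ∞ :=
  sInf {n : ℕ∞ | ∃ k : ℕ, (k : ℕ∞) = n ∧ InjDimLE S k M}

/-- Minimal number of generators. -/
def genNumber (S : Type) [CommRing S] (M : Type) [AddCommGroup M] [Module S M] : ℕ∞ :=
  sInf {n : ℕ∞ | ∃ s : Finset M, (s.card : ℕ∞) = n ∧ Submodule.span S (↑s : Set M) = ⊤}

/-- The socle `0 :_M J`. -/
def socle (S : Type) [CommRing S] (J : Ideal S) (M : Type) [AddCommGroup M] [Module S M] :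
    Submodule S M :=
  ⨅ r ∈ J, LinearMap.ker (LinearMap.lsmul S M r)

/-- Limit closure of the sequence `x` on `M`. -/
def limClo (S : Type) [CommRing S] {v : ℕ} (x : Fin v → S) (M : Type) [AddCommGroup M]
    [Module S M] : Submodule S M :=
  ⨆ t : ℕ, (Ideal.span (Set.range fun i => x i ^ (t + 1)) • (⊤ : Submodule S M)).comap
      (LinearMap.lsmul S M ((∏ i, x i) ^ t))

end

/-- Krull dimension of a ring, valued in `WithBot ℕ∞`. -/
noncomputable def rdim (S : Type) [CommRing S] : WithBot ℕ∞ :=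
  Order.krullDim (PrimeSpectrum S)

section
open Opposite

namespace OldExt
variable {R : Type} [CommRing R] {X Y : ModuleCat.{0} R}

/-- the induced map on the Hom complexes -/
noncomputable def yonMap {X' X : ModuleCat.{0} R} (P' : ProjectiveResolution X') (P : ProjectiveResolution X) (Y : ModuleCat.{0} R)
    (φ : P'.complex ⟶ P.complex) :
    P.complex.linearYonedaObj R Y ⟶ P'.complex.linearYonedaObj R Y :=
  (HomologicalComplex.unopFunctor _ _).map
    (((((linearYoneda R (ModuleCat.{0} R)).obj Y).rightOp.mapHomologicalComplex _).map φ).op)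

lemma homologyUnop_naturality {K L : ChainComplex (ModuleCat.{0} R)ᵒᵖ ℕ} (ψ : K ⟶ L) (n : ℕ) :
    (L.homologyUnop n).hom ≫ (HomologicalComplex.homologyMap ψ n).unop =
      HomologicalComplex.homologyMap ((HomologicalComplex.unopFunctor _ _).map ψ.op) n ≫
        (K.homologyUnop n).hom := by
  have := HomologicalComplex.homologyOp_hom_naturality
    ((HomologicalComplex.unopFunctor _ _).map ψ.op) n
  exact congrArg Quiver.Hom.unop this

lemma isoExt_inv_naturality {X' X : ModuleCat.{0} R} (P' : ProjectiveResolution X')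
    (P : ProjectiveResolution X) (Y : ModuleCat.{0} R) (g : X' ⟶ X)
    (φ : P'.Hom P g) (n : ℕ) :
    (P.isoExt (R := R) n Y).inv ≫ ((Ext R (ModuleCat.{0} R) n).map g.op).app Y =
      HomologicalComplex.homologyMap (yonMap P' P Y φ.hom) n ≫ (P'.isoExt (R := R) n Y).inv := by
  have h := ProjectiveResolution.isoLeftDerivedObj_hom_naturality (P := P') (Q := P) g φ.hom
    φ.hom_f_zero_comp_π_f_zero (((linearYoneda R (ModuleCat.{0} R)).obj Y).rightOp) n
  have h2 := homologyUnop_naturality ((((linearYoneda R (ModuleCat.{0} R)).obj Y).rightOp.mapHomologicalComplex _).map φ.hom) n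
  have h' := congrArg Quiver.Hom.unop h
  refine (Category.assoc (obj := ModuleCat.{0} R) _ _ _).trans ?_
  refine (congrArg (fun z => _ ≫ z) h').trans ?_
  refine (Category.assoc (obj := ModuleCat.{0} R) _ _ _).symm.trans ?_
  refine (congrArg (fun z => z ≫ _) h2).trans ?_
  exact (Category.assoc (obj := ModuleCat.{0} R) _ _ _)

end OldExt

end

section
open Opposite

namespace OldExt
variable {R : Type} [CommRing R]

section cochain
variable (K : CochainComplex (ModuleCat.{0} R) ℕ) (n : ℕ)

/-- the class of a cocycle -/
noncomputable def homologyMk : LinearMap.ker (K.d n (n+1)).hom →ₗ[R] K.homology n :=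
  (K.liftCycles (ModuleCat.ofHom (LinearMap.ker (K.d n (n+1)).hom).subtype) (n+1) (by simp)
    (by ext x; exact x.2) ≫ K.homologyπ n).hom

lemma iCycles_injective : Function.Injective (K.iCycles n).hom :=
  (ModuleCat.mono_iff_injective _).1 inferInstance

lemma homologyMk_surjective : Function.Surjective (homologyMk K n) := by
  intro h
  obtain ⟨c, rfl⟩ := (ModuleCat.epi_iff_surjective (K.homologyπ n)).1 inferInstance h
  have hc : K.iCycles n c ∈ LinearMap.ker (K.d n (n+1)).hom := by
    have := K.iCycles_d n (n+1)
    exact LinearMap.congr_fun (congrArg ModuleCat.Hom.hom this) c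
  refine ⟨⟨_, hc⟩, ?_⟩
  simp only [homologyMk, ModuleCat.hom_comp, LinearMap.comp_apply]
  congr 1
  apply iCycles_injective
  have := K.liftCycles_i (ModuleCat.ofHom (LinearMap.ker (K.d n (n+1)).hom).subtype) (n+1) (by simp)
    (by ext x; exact x.2)
  exact LinearMap.congr_fun (congrArg ModuleCat.Hom.hom this) _

lemma homologyMk_eq_zero_iff (z : LinearMap.ker (K.d (n+1) (n+1+1)).hom) :
    homologyMk K (n+1) z = 0 ↔ ∃ w, (K.d n (n+1)).hom w = z.1 := by
  have hi := K.liftCycles_i (ModuleCat.ofHom (LinearMap.ker (K.d (n+1) (n+1+1)).hom).subtype) (n+1+1) (by simp)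
    (by ext x; exact x.2)
  have hi := LinearMap.congr_fun (congrArg ModuleCat.Hom.hom hi) z
  have hz := K.toCycles_comp_homologyπ n (n+1)
  have ht := K.toCycles_i n (n+1)
  have hex : (ShortComplex.mk _ _ hz).Exact :=
    ShortComplex.exact_of_g_is_cokernel _ (K.homologyIsCokernel n (n+1) (by simp))
  rw [ShortComplex.moduleCat_exact_iff] at hex
  constructor
  · intro h
    obtain ⟨w, hw⟩ := hex _ h
    refine ⟨w, ?_⟩
    rw [← ht]
    refine Eq.trans ?_ hi
    exact congrArg (K.iCycles (n+1)).hom hw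
  · rintro ⟨w, hw⟩
    have : (K.toCycles n (n+1)).hom w = (K.liftCycles (ModuleCat.ofHom (LinearMap.ker (K.d (n+1) (n+1+1)).hom).subtype) (n+1+1) (by simp)
    (by ext x; exact x.2)).hom z := by
      apply iCycles_injective
      refine Eq.trans ?_ hi.symm
      refine Eq.trans ?_ hw
      exact LinearMap.congr_fun (congrArg ModuleCat.Hom.hom ht) w
    have h2 := LinearMap.congr_fun (congrArg ModuleCat.Hom.hom hz) w
    refine Eq.trans ?_ h2
    exact congrArg (K.homologyπ (n+1)).hom this.symm

variable {K}
lemma homologyMap_homologyMk {L : CochainComplex (ModuleCat.{0} R) ℕ} (ψ : K ⟶ L)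
    (z : LinearMap.ker (K.d n (n+1)).hom) (z' : LinearMap.ker (L.d n (n+1)).hom)
    (h : (ψ.f n).hom z.1 = z'.1) :
    (HomologicalComplex.homologyMap ψ n).hom (homologyMk K n z) = homologyMk L n z' := by
  have h1 := HomologicalComplex.homologyπ_naturality ψ n
  have h2 := LinearMap.congr_fun (congrArg ModuleCat.Hom.hom h1) ((K.liftCycles (ModuleCat.ofHom (LinearMap.ker (K.d n (n+1)).hom).subtype) (n+1) (by simp)
    (by ext x; exact x.2)).hom z)
  refine Eq.trans h2 ?_
  refine congrArg (L.homologyπ n).hom ?_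
  apply iCycles_injective
  have hi := K.liftCycles_i (ModuleCat.ofHom (LinearMap.ker (K.d (n) (n+1)).hom).subtype) (n+1) (by simp)
    (by ext x; exact x.2)
  have hi := LinearMap.congr_fun (congrArg ModuleCat.Hom.hom hi) z
  have hi' := L.liftCycles_i (ModuleCat.ofHom (LinearMap.ker (L.d (n) (n+1)).hom).subtype) (n+1) (by simp)
    (by ext x; exact x.2)
  have hi' := LinearMap.congr_fun (congrArg ModuleCat.Hom.hom hi') z'
  refine Eq.trans ?_ hi'.symm
  refine Eq.trans ?_ h
  refine Eq.trans ?_ (congrArg (ψ.f n).hom hi)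
  exact LinearMap.congr_fun (congrArg ModuleCat.Hom.hom (HomologicalComplex.cyclesMap_i ψ n)) _

end cochain

end OldExt

end

section
open Opposite

namespace OldExt
variable {R : Type} [CommRing R]
section
variable {X : ModuleCat.{0} R} (P : ProjectiveResolution X) (Y : ModuleCat.{0} R) (n : ℕ)

abbrev yonedaCocycles := LinearMap.ker ((P.complex.linearYonedaObj R Y).d n (n+1)).hom

noncomputable def newMk : yonedaCocycles P Y n →ₗ[R] Abelian.Ext.{0} X Y n where
  toFun z := P.extMk z.1 (n+1) rfl z.2
  map_add' z w := (P.add_extMk _ _ _ _ _ _).symm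
  map_smul' r z := by
    dsimp only [RingHom.id_apply]
    rw [Abelian.Ext.smul_eq_comp_mk₀]
    refine Eq.trans ?_ (P.extMk_comp_mk₀ _ _ _ z.2 _).symm
    show P.extMk (r • (show P.complex.X n ⟶ Y from z.1)) _ _ _ = P.extMk ((show P.complex.X n ⟶ Y from z.1) ≫ (r • 𝟙 Y)) _ _ _
    congr 1

lemma newMk_surjective : Function.Surjective (newMk P Y n) := by
  intro e
  obtain ⟨f, hf, rfl⟩ := P.extMk_surjective e (n+1) rfl
  exact ⟨⟨f, hf⟩, rfl⟩

noncomputable def oldMk : yonedaCocycles P Y n →ₗ[R] ((Ext R (ModuleCat.{0} R) n).obj (op X)).obj Y :=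
  (P.isoExt (R := R) n Y).inv.hom ∘ₗ homologyMk _ n

lemma oldMk_surjective : Function.Surjective (oldMk P Y n) :=
  ((P.isoExt (R := R) n Y).toLinearEquiv.symm.surjective).comp (homologyMk_surjective _ n)

lemma ker_eq : LinearMap.ker (newMk P Y (n+1)) = LinearMap.ker (oldMk P Y (n+1)) := by
  ext z
  rw [LinearMap.mem_ker, LinearMap.mem_ker]
  refine (P.extMk_eq_zero_iff z.1 _ rfl z.2 n rfl).trans ?_
  refine (homologyMk_eq_zero_iff (P.complex.linearYonedaObj R Y) n z).symm.trans ?_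
  exact ((P.isoExt (R := R) (n+1) Y).toLinearEquiv.symm.map_eq_zero_iff).symm

noncomputable def extEquiv : Abelian.Ext.{0} X Y (n+1) ≃ₗ[R] ((Ext R (ModuleCat.{0} R) (n+1)).obj (op X)).obj Y :=
  (LinearMap.quotKerEquivOfSurjective _ (newMk_surjective P Y (n+1))).symm ≪≫ₗ
    Submodule.quotEquivOfEq _ _ (ker_eq P Y n) ≪≫ₗ
    (LinearMap.quotKerEquivOfSurjective _ (oldMk_surjective P Y (n+1)))

lemma extEquiv_newMk (z) : extEquiv P Y n (newMk P Y (n+1) z) = oldMk P Y (n+1) z := by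
  have : (LinearMap.quotKerEquivOfSurjective _ (newMk_surjective P Y (n+1))).symm (newMk P Y (n+1) z) = Submodule.Quotient.mk z := by
    rw [LinearEquiv.symm_apply_eq]; rfl
  simp only [extEquiv, LinearEquiv.trans_apply, this]
  rfl

end

noncomputable def extLinearEquiv (X Y : ModuleCat.{0} R) (n : ℕ) :
   Abelian.Ext.{0} X Y (n+1) ≃ₗ[R] ((Ext R (ModuleCat.{0} R) (n+1)).obj (op X)).obj Y :=
  extEquiv (projectiveResolution X) Y n

lemma extLinearEquiv_naturality {X' X : ModuleCat.{0} R} (g : X' ⟶ X) (Y : ModuleCat.{0} R) (n : ℕ) (a : Abelian.Ext.{0} X Y (n+1)) :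
    extLinearEquiv X' Y n ((Abelian.Ext.mk₀ g).comp a (zero_add _)) =
      (((Ext R (ModuleCat.{0} R) (n+1)).map g.op).app Y).hom (extLinearEquiv X Y n a) := by
  obtain ⟨z, rfl⟩ := newMk_surjective (projectiveResolution X) Y (n+1) a
  let φ : (projectiveResolution X').Hom (projectiveResolution X) g :=
    ⟨ProjectiveResolution.lift g _ _, ProjectiveResolution.lift_commutes_zero _ _ _⟩
  have h1 : (Abelian.Ext.mk₀ g).comp (newMk (projectiveResolution X) Y (n+1) z) (zero_add _) =
      newMk (projectiveResolution X') Y (n+1) ⟨φ.hom.f (n+1) ≫ z.1, by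
        have h : (projectiveResolution X).complex.d (n+1+1) (n+1) ≫
          (show (projectiveResolution X).complex.X (n+1) ⟶ Y from z.1) = 0 := z.2
        show (projectiveResolution X').complex.d (n+1+1) (n+1) ≫ φ.hom.f (n+1) ≫
          (show (projectiveResolution X).complex.X (n+1) ⟶ Y from z.1) = 0
        rw [← φ.hom.comm_assoc, h, Limits.comp_zero]⟩ :=
    ProjectiveResolution.mk₀_comp_extMk (R := projectiveResolution X) z.1 _ rfl z.2 φ
  rw [h1]
  dsimp only [extLinearEquiv]
  rw [extEquiv_newMk, extEquiv_newMk]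
  have h2 := LinearMap.congr_fun (congrArg ModuleCat.Hom.hom (isoExt_inv_naturality _ _ Y g φ (n+1))) (homologyMk _ (n+1) z)
  refine Eq.trans ?_ h2.symm
  refine congrArg ((projectiveResolution X').isoExt (R := R) (n + 1) Y).inv.hom ?_
  symm
  apply homologyMap_homologyMk
  rfl

end OldExt

end

section
open Opposite

/-- The truncation `R ⧸ I → R ⧸ J`. -/
noncomputable def ringQuotHom {R : Type} [CommRing R] {I J : Ideal R} (h : I ≤ J) :
    ModuleCat.of R (R ⧸ I) ⟶ ModuleCat.of R (R ⧸ J) :=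
  ModuleCat.ofHom (Submodule.mapQ I J LinearMap.id h)

noncomputable def powHom {R : Type} [CommRing R] (J : Ideal R) {t s : ℕ} (h : t ≤ s) :
    ModuleCat.of R (R ⧸ J ^ s) ⟶ ModuleCat.of R (R ⧸ J ^ t) :=
  ringQuotHom (Ideal.pow_le_pow_right h)

/-- restriction of `Ext` classes along `R ⧸ J ^ s → R ⧸ J ^ t` -/
noncomputable def res {R : Type} [CommRing R] (J : Ideal R) {N : ModuleCat.{0} R} {i : ℕ} {t s : ℕ} (h : t ≤ s)
    (e : Abelian.Ext.{0} (ModuleCat.of R (R ⧸ J ^ t)) N i) : Abelian.Ext.{0} (ModuleCat.of R (R ⧸ J ^ s)) N i :=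
  (Abelian.Ext.mk₀ (powHom J h)).comp e (zero_add i)

structure IsExtColim {R : Type} [CommRing R] (J : Ideal R) (N : ModuleCat.{0} R) (i : ℕ)
    (H : Type) [AddCommGroup H] [Module R H]
    (ι : ∀ t : ℕ, Abelian.Ext.{0} (ModuleCat.of R (R ⧸ J ^ t)) N i →ₗ[R] H) : Prop where
  res : ∀ {t s : ℕ} (h : t ≤ s) (e), ι s (res J h e) = ι t e
  surj : ∀ x : H, ∃ t e, ι t e = x
  zero : ∀ t e, ι t e = 0 → ∃ (s : ℕ) (h : t ≤ s), _root_.res J h e = 0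

open Limits in
theorem LC_isExtColim {R : Type} [CommRing R] (J : Ideal R) (N : ModuleCat.{0} R) (n : ℕ) :
    ∃ ι, IsExtColim J N (n+1) ((localCohomology J (n+1)).obj N) ι := by
  let D := localCohomology.diagram (localCohomology.idealPowersDiagram J) (n+1)
  let ev := (evaluation (ModuleCat.{0} R) (ModuleCat.{0} R)).obj N
  let c := ev.mapCocone (colimit.cocone D)
  have hc : IsColimit c := isColimitOfPreserves ev (colimit.isColimit D)
  let F : (ℕᵒᵖ)ᵒᵖ ⥤ ModuleCat.{0} R := D ⋙ ev
  have nat : ∀ {t s : ℕ} (h : t ≤ s) (e : Abelian.Ext.{0} (ModuleCat.of R (R ⧸ J ^ t)) N (n+1)),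
     OldExt.extLinearEquiv _ N n (res J h e) = (F.map (homOfLE h).op.op).hom (OldExt.extLinearEquiv _ N n e) := by
    intro t s h e
    exact OldExt.extLinearEquiv_naturality (powHom J h) N n e
  refine ⟨fun t => (c.ι.app (op (op t))).hom ∘ₗ (OldExt.extLinearEquiv _ N n).toLinearMap, ?_, ?_, ?_⟩
  · intro t s h e
    have h1 := LinearMap.congr_fun (congrArg ModuleCat.Hom.hom (c.w (homOfLE h).op.op)) (OldExt.extLinearEquiv _ N n e)
    refine Eq.trans ?_ h1
    refine congrArg (c.ι.app (op (op s))).hom (nat h e)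
  · intro x
    obtain ⟨t, y, hy⟩ := Concrete.isColimit_exists_rep F hc x
    refine ⟨t.unop.unop, (OldExt.extLinearEquiv _ N n).symm y, ?_⟩
    refine Eq.trans ?_ hy
    refine congrArg (c.ι.app t).hom ?_
    exact (OldExt.extLinearEquiv _ N n).apply_symm_apply y
  · intro t e he
    have h0 : c.ι.app (op (op t)) (OldExt.extLinearEquiv _ N n e) = c.ι.app (op (op t)) 0 := by
      rw [map_zero]; exact he
    obtain ⟨k, f, g, hfg⟩ := Concrete.isColimit_exists_of_rep_eq F hc _ _ h0
    have h : t ≤ k.unop.unop := leOfHom f.unop.unop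
    refine ⟨k.unop.unop, h, ?_⟩
    rw [map_zero] at hfg
    apply (OldExt.extLinearEquiv _ N n).injective
    rw [nat, map_zero]
    exact hfg

end

/-- Yoneda `Ext` groups of modules -/
abbrev EX {R : Type} [CommRing R] (A N : ModuleCat.{0} R) (i : ℕ) : Type := Abelian.Ext.{0} A N i

namespace EX
variable {R : Type} [CommRing R] {A A' A'' N N' N'' : ModuleCat.{0} R} {i : ℕ}

/-- pushforward in the second variable -/
noncomputable def push (f : N ⟶ N') : EX A N i →ₗ[R] EX A N' i where
  toFun e := Abelian.Ext.comp e (Abelian.Ext.mk₀ f) (add_zero i)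
  map_add' _ _ := Abelian.Ext.add_comp _ _ _ _
  map_smul' _ _ := Abelian.Ext.smul_comp _ _ _ _

/-- pullback in the first variable -/
noncomputable def pull (g : A' ⟶ A) : EX A N i →ₗ[R] EX A' N i where
  toFun e := (Abelian.Ext.mk₀ g).comp e (zero_add i)
  map_add' _ _ := Abelian.Ext.comp_add _ _ _ _
  map_smul' _ _ := Abelian.Ext.comp_smul _ _ _ _

/-- covariant connecting map -/
noncomputable def del {S : ShortComplex (ModuleCat.{0} R)} (hS : S.ShortExact) :
    EX A S.X₃ i →ₗ[R] EX A S.X₁ (i+1) where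
  toFun e := Abelian.Ext.comp e hS.extClass rfl
  map_add' _ _ := Abelian.Ext.add_comp _ _ _ _
  map_smul' _ _ := Abelian.Ext.smul_comp _ _ _ _

/-- contravariant connecting map -/
noncomputable def cdel {S : ShortComplex (ModuleCat.{0} R)} (hS : S.ShortExact) :
    EX S.X₁ N i →ₗ[R] EX S.X₃ N (i+1) where
  toFun e := Abelian.Ext.comp hS.extClass e (add_comm 1 i)
  map_add' _ _ := Abelian.Ext.comp_add _ _ _ _
  map_smul' _ _ := Abelian.Ext.comp_smul _ _ _ _

lemma push_push (f : N ⟶ N') (g : N' ⟶ N'') (e : EX A N i) : push g (push f e) = push (f ≫ g) e := by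
  dsimp only [push, pull, del, cdel, LinearMap.coe_mk, AddHom.coe_mk]
  simp

lemma pull_pull (f : A' ⟶ A) (g : A'' ⟶ A') (e : EX A N i) : pull g (pull f e) = pull (g ≫ f) e := by
  dsimp only [push, pull, del, cdel, LinearMap.coe_mk, AddHom.coe_mk]
  rw [← Abelian.Ext.mk₀_comp_mk₀_assoc]

lemma pull_push (g : A' ⟶ A) (f : N ⟶ N') (e : EX A N i) : pull g (push f e) = push f (pull g e) := by
  dsimp only [push, pull, del, cdel, LinearMap.coe_mk, AddHom.coe_mk]
  rw [Abelian.Ext.comp_assoc_of_third_deg_zero]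

lemma pull_del {S : ShortComplex (ModuleCat.{0} R)} (hS : S.ShortExact) (g : A' ⟶ A) (e : EX A S.X₃ i) :
    pull g (del hS e) = del hS (pull g e) := by
  dsimp only [push, pull, del, cdel, LinearMap.coe_mk, AddHom.coe_mk]
  rw [Abelian.Ext.comp_assoc _ _ _ _ _ (by lia)]

lemma push_cdel {S : ShortComplex (ModuleCat.{0} R)} (hS : S.ShortExact) (f : N ⟶ N') (e : EX S.X₁ N i) :
    push f (cdel hS e) = cdel hS (push f e) := by
  dsimp only [push, pull, del, cdel, LinearMap.coe_mk, AddHom.coe_mk]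
  rw [Abelian.Ext.comp_assoc _ _ _ _ _ (by lia)]

lemma push_smul_id (r : R) (e : EX A N i) : push (r • 𝟙 N) e = r • e :=
  (Abelian.Ext.smul_eq_comp_mk₀ _ _).symm

lemma push_id (e : EX A N i) : push (𝟙 N) e = e := Abelian.Ext.comp_mk₀_id _

lemma pull_id (e : EX A N i) : pull (𝟙 A) e = e := Abelian.Ext.mk₀_id_comp _

lemma push_smul (r : R) (f : N ⟶ N') (e : EX A N i) : push (r • f) e = r • push f e := by
  dsimp only [push, pull, del, cdel, LinearMap.coe_mk, AddHom.coe_mk]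
  rw [Abelian.Ext.mk₀_smul, Abelian.Ext.comp_smul]

lemma pull_smul (r : R) (g : A' ⟶ A) (e : EX A N i) : pull (r • g) e = r • pull g e := by
  dsimp only [push, pull, del, cdel, LinearMap.coe_mk, AddHom.coe_mk]
  rw [Abelian.Ext.mk₀_smul, Abelian.Ext.smul_comp]

lemma push_add (f g : N ⟶ N') (e : EX A N i) : push (f + g) e = push f e + push g e := by
  dsimp only [push, pull, del, cdel, LinearMap.coe_mk, AddHom.coe_mk]
  rw [Abelian.Ext.mk₀_add, Abelian.Ext.comp_add]

lemma pull_zero (e : EX A N i) : pull (0 : A' ⟶ A) e = 0 := by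
  dsimp only [push, pull, del, cdel, LinearMap.coe_mk, AddHom.coe_mk]
  rw [Abelian.Ext.mk₀_zero, Abelian.Ext.zero_comp]

section exact
variable {S : ShortComplex (ModuleCat.{0} R)}

lemma exact₁ (hS : S.ShortExact) (e : EX A S.X₁ (i+1)) (h : push S.f e = 0) : ∃ e', del hS (i := i) e' = e :=
  Abelian.Ext.covariant_sequence_exact₁ A hS e h rfl

lemma exact₂ (hS : S.ShortExact) (e : EX A S.X₂ i) (h : push S.g e = 0) : ∃ e', push S.f e' = e :=
  Abelian.Ext.covariant_sequence_exact₂ A hS e h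

lemma exact₃ (hS : S.ShortExact) (e : EX A S.X₃ i) (h : del hS e = 0) : ∃ e', push S.g e' = e :=
  Abelian.Ext.covariant_sequence_exact₃ A hS e rfl h

lemma push_f_del (hS : S.ShortExact) (e : EX A S.X₃ i) : push S.f (del hS e) = 0 := by
  dsimp only [push, pull, del, cdel, LinearMap.coe_mk, AddHom.coe_mk]
  simp

lemma del_push_g (hS : S.ShortExact) (e : EX A S.X₂ i) : del hS (push S.g e) = 0 := by
  dsimp only [push, pull, del, cdel, LinearMap.coe_mk, AddHom.coe_mk]
  simp

lemma push_f_injective (hS : S.ShortExact) : Function.Injective (push S.f : EX A S.X₁ 0 → EX A S.X₂ 0) :=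
  haveI := hS.mono_f
  Abelian.Ext.postcomp_mk₀_injective_of_mono A S.f

lemma cexact₃ (hS : S.ShortExact) (e : EX S.X₃ N (i+1)) (h : pull S.g e = 0) : ∃ e', cdel hS (i := i) e' = e :=
  Abelian.Ext.contravariant_sequence_exact₃ hS N e h (add_comm 1 i)

end exact

lemma smul_eq_zero_of_left {r : R} (h : ∀ a : A, r • a = 0) (e : EX A N i) : r • e = 0 := by
  rw [← pull_id e, ← pull_smul]
  have : r • 𝟙 A = 0 := by ext a; exact h a
  rw [this, pull_zero]

lemma eq_zero_of_proj (h : Module.Projective R A) (e : EX A N (i+1)) : e = 0 :=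
  haveI := (IsProjective.iff_projective (R := R) A).1 h
  Abelian.Ext.eq_zero_of_projective e

lemma push_mk₀ (f : N ⟶ N') (g : A ⟶ N) : push f (Abelian.Ext.mk₀ g) = Abelian.Ext.mk₀ (g ≫ f) :=
  Abelian.Ext.mk₀_comp_mk₀ _ _

lemma pull_mk₀ (f : A' ⟶ A) (g : A ⟶ N) : pull f (Abelian.Ext.mk₀ g) = Abelian.Ext.mk₀ (f ≫ g) :=
  Abelian.Ext.mk₀_comp_mk₀ _ _

lemma exists_mk₀ (e : EX A N 0) : ∃ f : A ⟶ N, e = Abelian.Ext.mk₀ f :=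
  let ⟨f, h⟩ := (Abelian.Ext.mk₀_bijective A N).2 e
  ⟨f, h.symm⟩

lemma mk₀_inj {f g : A ⟶ N} (h : Abelian.Ext.mk₀.{0} f = Abelian.Ext.mk₀ g) : f = g :=
  (Abelian.Ext.mk₀_bijective A N).1 h

end EX

lemma res_eq {R : Type} [CommRing R] (J : Ideal R) {N : ModuleCat.{0} R} {i : ℕ} {t s : ℕ} (h : t ≤ s)
    (e : EX (ModuleCat.of R (R ⧸ J ^ t)) N i) : res J h e = EX.pull (powHom J h) e := rfl

/-- an embedding into an injective module, with its cokernel -/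
noncomputable def injSES {R : Type} [CommRing R] (N : ModuleCat.{0} R) : ShortComplex (ModuleCat.{0} R) :=
  ShortComplex.mk (Injective.ι N) (Limits.cokernel.π (Injective.ι N)) (by simp)

lemma injSES_exact {R : Type} [CommRing R] (N : ModuleCat.{0} R) : (injSES N).ShortExact :=
  { exact := ShortComplex.exact_cokernel _
    mono_f := by dsimp [injSES]; infer_instance
    epi_g := by dsimp [injSES]; infer_instance }

lemma injSES_inj {R : Type} [CommRing R] (N : ModuleCat.{0} R) : Injective (injSES N).X₂ := by
  dsimp [injSES]; infer_instance

namespace EX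
variable {R S : Type} [CommRing R] [CommRing S] {f : R →+* S}

lemma injective_restrict (hf : f.Flat) (N : ModuleCat.{0} S) (hN : Injective N) :
    Injective ((ModuleCat.restrictScalars f).obj N) := by
  have := ModuleCat.preservesFiniteLimits_extendScalars_of_flat hf
  exact Adjunction.map_injective (ModuleCat.extendRestrictScalarsAdj f) N hN

variable {X : ModuleCat.{0} R} {A : ModuleCat.{0} S} (u : X ⟶ (ModuleCat.restrictScalars f).obj A)

/-- restriction of scalars on `Ext`, followed by pulling back along `u` -/
noncomputable def restrict {N : ModuleCat.{0} S} {i : ℕ} : EX A N i →+ EX X ((ModuleCat.restrictScalars f).obj N) i where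
  toFun e := pull u (e.mapExactFunctor (ModuleCat.restrictScalars f))
  map_zero' := by simp
  map_add' _ _ := by simp

lemma restrict_push {N N' : ModuleCat.{0} S} {i : ℕ} (g : N ⟶ N') (e : EX A N i) :
    restrict u (push g e) = push ((ModuleCat.restrictScalars f).map g) (restrict u e) := by
  show pull u (Abelian.Ext.mapExactFunctor _ (Abelian.Ext.comp e (Abelian.Ext.mk₀ g) (add_zero i))) = push _ (pull u _)
  rw [Abelian.Ext.mapExactFunctor_comp, Abelian.Ext.mapExactFunctor_mk₀, ← pull_push]
  rfl

lemma restrict_smul {N : ModuleCat.{0} S} {i : ℕ} (r : R) (e : EX A N i) :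
    restrict u (f r • e) = r • restrict u e := by
  rw [← push_smul_id, restrict_push, ← push_smul_id]
  rfl

lemma restrict_del {T : ShortComplex (ModuleCat.{0} S)} (hT : T.ShortExact) {i : ℕ} (e : EX A T.X₃ i) :
    (restrict u (N := T.X₁) (del hT e)) = del (S := T.map (ModuleCat.restrictScalars f))
      (hT.map_of_exact (ModuleCat.restrictScalars f)) (restrict u (N := T.X₃) e) := by
  show pull u (Abelian.Ext.mapExactFunctor (ModuleCat.restrictScalars f) (Abelian.Ext.comp e hT.extClass rfl)) =
    del (S := T.map (ModuleCat.restrictScalars f)) _ (pull u _)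
  rw [Abelian.Ext.mapExactFunctor_comp, Abelian.Ext.mapExactFunctor_extClass]
  exact pull_del (S := T.map (ModuleCat.restrictScalars f))
    (hT.map_of_exact (ModuleCat.restrictScalars f)) u (Abelian.Ext.mapExactFunctor _ e)

lemma restrict_pull {X' : ModuleCat.{0} R} {A' : ModuleCat.{0} S} (u' : X' ⟶ (ModuleCat.restrictScalars f).obj A')
    (g : X' ⟶ X) (g' : A' ⟶ A) (h : g ≫ u = u' ≫ (ModuleCat.restrictScalars f).map g')
    {N : ModuleCat.{0} S} {i : ℕ} (e : EX A N i) :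
    restrict u' (pull g' e) = pull g (restrict u e) := by
  show pull u' (Abelian.Ext.mapExactFunctor _ (Abelian.Ext.comp (Abelian.Ext.mk₀ g') e (zero_add i))) = pull g (pull u _)
  rw [Abelian.Ext.mapExactFunctor_comp, pull_pull, h, ← pull_pull, Abelian.Ext.mapExactFunctor_mk₀]
  rfl

lemma restrict_bijective (hf : f.Flat)
    (hu : ∀ N : ModuleCat.{0} S, Function.Bijective
      (fun g : A ⟶ N => (u ≫ (ModuleCat.restrictScalars f).map g : X ⟶ _)))
    (i : ℕ) (N : ModuleCat.{0} S) : Function.Bijective (restrict u : EX A N i →+ _) := by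
  induction i generalizing N with
  | zero =>
    have h0 : ∀ g : A ⟶ N, restrict u (Abelian.Ext.mk₀ g) = Abelian.Ext.mk₀ (u ≫ (ModuleCat.restrictScalars f).map g) := by
      intro g
      show pull u (Abelian.Ext.mapExactFunctor _ _) = _
      rw [Abelian.Ext.mapExactFunctor_mk₀, pull_mk₀]
    constructor
    · intro a b h
      obtain ⟨a, rfl⟩ := exists_mk₀ a
      obtain ⟨b, rfl⟩ := exists_mk₀ b
      rw [h0, h0] at h
      exact congrArg _ ((hu N).1 (mk₀_inj h))
    · intro b
      obtain ⟨b, rfl⟩ := exists_mk₀ b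
      obtain ⟨g, hg⟩ := (hu N).2 b
      exact ⟨Abelian.Ext.mk₀ g, by rw [h0]; exact congrArg _ hg⟩
  | succ i ih =>
    have hT := injSES_exact N
    have hT' := hT.map_of_exact (ModuleCat.restrictScalars f)
    have hI := injSES_inj N
    have hI' : Injective ((injSES N).map (ModuleCat.restrictScalars f)).X₂ := injective_restrict hf _ hI
    constructor
    · rw [injective_iff_map_eq_zero]
      intro e he
      obtain ⟨e', rfl⟩ := exact₁ hT (A := A) e (Abelian.Ext.eq_zero_of_injective _)
      have he' := (restrict_del u hT e').symm.trans he
      obtain ⟨a, ha⟩ := exact₃ hT' _ he'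
      obtain ⟨a, rfl⟩ := (ih _).2 a
      have : restrict u (push (injSES N).g a) = restrict u e' := by
        rw [restrict_push]; exact ha
      rw [← (ih _).1 this]
      exact del_push_g hT a
    · intro b
      obtain ⟨b', rfl⟩ := exact₁ hT' (A := X) (i := i) b (Abelian.Ext.eq_zero_of_injective _)
      obtain ⟨a, rfl⟩ := (ih _).2 b'
      exact ⟨del hT a, restrict_del u hT a⟩

end EX

section baseChange
variable {R S : Type} [CommRing R] [CommRing S] (f : R →+* S) (I : Ideal R)

/-- the map `R ⧸ I ^ t → S ⧸ (I S) ^ t` -/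
noncomputable def quotPowMap (t : ℕ) : ModuleCat.of R (R ⧸ I ^ t) ⟶
    (ModuleCat.restrictScalars f).obj (ModuleCat.of S (S ⧸ (I.map f) ^ t)) :=
  letI := f.toAlgebra
  ModuleCat.ofHom (Y := (ModuleCat.restrictScalars f).obj (ModuleCat.of S (S ⧸ (I.map f) ^ t)))
  { toFun := Ideal.quotientMap ((I.map f) ^ t) f (by
      rw [← Ideal.map_pow]; exact Ideal.le_comap_map)
    map_add' := map_add _
    map_smul' := by
      intro r x
      obtain ⟨x, rfl⟩ := Ideal.Quotient.mk_surjective x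
      show Ideal.quotientMap _ f _ (Ideal.Quotient.mk _ (r * x)) = _
      rw [Ideal.quotientMap_mk, map_mul, map_mul]
      rfl }

lemma quotPowMap_bijective (t : ℕ) (N : ModuleCat.{0} S) : Function.Bijective
      (fun g : ModuleCat.of S (S ⧸ (I.map f) ^ t) ⟶ N =>
        (quotPowMap f I t ≫ (ModuleCat.restrictScalars f).map g : _ ⟶ _)) := by
  constructor
  · intro g g' h
    ext1
    apply Submodule.linearMap_qext
    apply LinearMap.ext_ring
    have := LinearMap.congr_fun (congrArg ModuleCat.Hom.hom h) (Ideal.Quotient.mk _ 1)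
    have e1 : Ideal.Quotient.mk ((I.map f) ^ t) (f 1) = 1 := by rw [map_one, map_one]
    have this : g.hom (Ideal.Quotient.mk _ (f 1)) = g'.hom (Ideal.Quotient.mk _ (f 1)) := this
    rw [e1] at this
    exact this
  · intro h
    let n : N := h.hom (Ideal.Quotient.mk _ 1)
    have hn : ∀ a ∈ I ^ t, f a • n = 0 := by
      intro a ha
      have : h.hom (a • (Ideal.Quotient.mk (I ^ t) 1)) = f a • n := h.hom.map_smul a _
      rw [← this]
      have h0 : a • (Ideal.Quotient.mk (I ^ t) 1) = 0 := by
        refine Eq.trans ?_ (Ideal.Quotient.eq_zero_iff_mem.2 ha)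
        show Ideal.Quotient.mk (I ^ t) (a * 1) = _
        rw [mul_one]
      exact (congrArg h.hom h0).trans (map_zero _)
    refine ⟨ModuleCat.ofHom (Submodule.liftQ _ (LinearMap.toSpanSingleton S N n) ?_), ?_⟩
    · rw [← Ideal.map_pow, Ideal.map_le_iff_le_comap]
      intro a ha
      exact hn a ha
    · ext1
      apply Submodule.linearMap_qext
      apply LinearMap.ext_ring
      show f 1 • n = n
      rw [map_one, one_smul]

end baseChange

theorem IsExtColim.restrict {R S : Type} [CommRing R] [CommRing S] {f : R →+* S} (hf : f.Flat) {I : Ideal R}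
    {N : ModuleCat.{0} S} {i : ℕ} {H : Type} [AddCommGroup H] [Module S H] [Module R H]
    (hRS : ∀ (r : R) (h : H), r • h = f r • h)
    {ι} (h : IsExtColim (I.map f) N i H ι) :
    ∃ ι', IsExtColim I ((ModuleCat.restrictScalars f).obj N) i H ι' := by
  have hb := fun t => EX.restrict_bijective (quotPowMap f I t) hf (quotPowMap_bijective f I t) i N
  let e := fun t => AddEquiv.ofBijective _ (hb t)
  have he : ∀ t x, e t x = EX.restrict (quotPowMap f I t) x := fun _ _ => rfl
  have hres : ∀ {t s : ℕ} (h : t ≤ s) x, _root_.res I h (e t x) = e s (_root_.res (I.map f) h x) := by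
    intro t s h x
    rw [res_eq, res_eq, he, he]
    refine (EX.restrict_pull _ _ _ _ ?_ x).symm
    ext1
    apply Submodule.linearMap_qext
    apply LinearMap.ext_ring
    rfl
  refine ⟨fun t => { toFun := fun x => ι t ((e t).symm x), map_add' := by simp, map_smul' := ?_}, ?_, ?_, ?_⟩
  · intro r x
    obtain ⟨x, rfl⟩ := (e t).surjective x
    have : r • e t x = e t (f r • x) := (EX.restrict_smul _ r x).symm
    rw [this, AddEquiv.symm_apply_apply, AddEquiv.symm_apply_apply, map_smul, RingHom.id_apply, hRS]
  · intro t s hts x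
    obtain ⟨x, rfl⟩ := (e t).surjective x
    simp only [LinearMap.coe_mk, AddHom.coe_mk]
    rw [hres, AddEquiv.symm_apply_apply, AddEquiv.symm_apply_apply, h.res]
  · intro x
    obtain ⟨t, y, rfl⟩ := h.surj x
    exact ⟨t, e t y, by simp⟩
  · intro t x hx
    obtain ⟨x, rfl⟩ := (e t).surjective x
    simp only [LinearMap.coe_mk, AddHom.coe_mk, AddEquiv.symm_apply_apply] at hx
    obtain ⟨s, hs, h0⟩ := h.zero t x hx
    exact ⟨s, hs, by rw [hres, h0, map_zero]⟩

section flat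
open TensorProduct
variable {R : Type} [CommRing R] [IsNoetherianRing R] (D : Type) [AddCommGroup D] [Module R D] [Module.Flat R D]

lemma rTensorHomToHomRTensor_surjective (X M : Type) [AddCommGroup X] [Module R X] [Module.Finite R X]
    [AddCommGroup M] [Module R M] :
    Function.Surjective (rTensorHomToHomRTensor (.id R) X M D) := by
  intro h
  obtain ⟨n, π, hπ⟩ := Module.Finite.exists_fin' R X
  obtain ⟨k, φ', hφ'⟩ := Module.Finite.exists_fin' R (LinearMap.ker π)
  let φ : (Fin k → R) →ₗ[R] (Fin n → R) := (LinearMap.ker π).subtype ∘ₗ φ'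
  have hex : Function.Exact φ π := by
    rw [LinearMap.exact_iff]
    rw [LinearMap.range_comp, LinearMap.range_eq_top.2 hφ', Submodule.map_top, Submodule.range_subtype]
  have e1 : Function.Exact (LinearMap.lcomp R M π) (LinearMap.lcomp R M φ) := by
    intro g
    constructor
    · intro hg
      refine ⟨(Function.Exact.linearEquivOfSurjective hex hπ) |>.symm.toLinearMap |> fun e =>
        (Submodule.liftQ _ g (by
          rw [LinearMap.range_le_ker_iff]; exact hg)) ∘ₗ e, ?_⟩
      ext x
      simp
    · rintro ⟨g, rfl⟩
      ext x
      simp [hex.apply_apply_eq_zero]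
  have e2 := Module.Flat.rTensor_exact D e1
  let E := rTensorHomEquivHomRTensor R (Fin n → R) M D
  let E' := rTensorHomEquivHomRTensor R (Fin k → R) M D
  have nat : ∀ w, E' ((LinearMap.lcomp R M φ).rTensor D w) = E w ∘ₗ φ := by
    intro w
    simp only [E, E', rTensorHomEquivHomRTensor_apply]
    induction w with
    | zero => simp
    | add a b ha hb => rw [map_add, map_add, ha, hb, map_add]; rfl
    | tmul a b => ext; simp
  have nat' : ∀ w, E ((LinearMap.lcomp R M π).rTensor D w) = rTensorHomToHomRTensor (.id R) X M D w ∘ₗ π := by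
    intro w
    simp only [E, rTensorHomEquivHomRTensor_apply]
    induction w with
    | zero => simp
    | add a b ha hb => rw [map_add, map_add, ha, hb, map_add]; rfl
    | tmul a b => ext; simp
  obtain ⟨w, hw⟩ := E.surjective (h ∘ₗ π)
  have : (LinearMap.lcomp R M φ).rTensor D w = 0 := by
    apply E'.injective
    rw [nat, hw, map_zero]
    ext x
    simp [hex.apply_apply_eq_zero]
  obtain ⟨v, rfl⟩ := (e2 w).1 this
  refine ⟨v, ?_⟩
  rw [nat'] at hw
  exact LinearMap.cancel_right hπ |>.1 hw

/-- `m ↦ m ⊗ d` -/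
noncomputable def tmulHom (M : ModuleCat.{0} R) {D : Type} [AddCommGroup D] [Module R D] (d : D) :
    M ⟶ ModuleCat.of R (M ⊗[R] D) :=
  ModuleCat.ofHom ((TensorProduct.mk R M D).flip d)

/-- the syzygy sequence of a finite module -/
lemma exists_syzygy (X : ModuleCat.{0} R) [Module.Finite R X] :
    ∃ T : ShortComplex (ModuleCat.{0} R), T.ShortExact ∧ T.X₃ = X ∧ Module.Finite R T.X₁ ∧ Module.Projective R T.X₂ := by
  obtain ⟨n, π, hπ⟩ := Module.Finite.exists_fin' R X
  refine ⟨ShortComplex.mk (ModuleCat.ofHom (LinearMap.ker π).subtype) (ModuleCat.ofHom π) (by ext; simp),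
    { exact := ?_, mono_f := ?_, epi_g := ?_ }, rfl, ?_, ?_⟩
  · exact (ShortComplex.ShortExact.moduleCat_exact_iff_function_exact _).2 (LinearMap.exact_subtype_ker_map π)
  · rw [ModuleCat.mono_iff_injective]; exact Subtype.val_injective
  · rw [ModuleCat.epi_iff_surjective]; exact hπ
  · show Module.Finite R (LinearMap.ker π); infer_instance
  · show Module.Projective R (Fin n → R); infer_instance

variable {D}
lemma EX.mem_span_tmul (M : ModuleCat.{0} R) (n : ℕ) (X : ModuleCat.{0} R) [Module.Finite R X]
    (e : EX X (ModuleCat.of R (M ⊗[R] D)) n) :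
    e ∈ Submodule.span R {x | ∃ (d : D) (e' : EX X M n), x = push (tmulHom M d) e'} := by
  induction n generalizing X with
  | zero =>
    obtain ⟨h, rfl⟩ := exists_mk₀ e
    obtain ⟨w, hw⟩ := rTensorHomToHomRTensor_surjective D X M h.hom
    have : h = ModuleCat.ofHom (rTensorHomToHomRTensor (.id R) X M D w) := by rw [hw]; rfl
    subst this
    clear hw
    induction w with
    | zero =>
      simp only [map_zero, ModuleCat.ofHom_zero, Abelian.Ext.mk₀_zero]; exact zero_mem _
    | add a b ha hb =>
      simp only [map_add, ModuleCat.ofHom_add, Abelian.Ext.mk₀_add]; exact add_mem ha hb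
    | tmul a b =>
      refine Submodule.subset_span ⟨b, Abelian.Ext.mk₀ (ModuleCat.ofHom a), ?_⟩
      rw [push_mk₀]
      rfl
  | succ n ih =>
    obtain ⟨T, hT, rfl, hf, hp⟩ := exists_syzygy X
    obtain ⟨e', rfl⟩ := cexact₃ hT e (eq_zero_of_proj hp _)
    have := Submodule.mem_map_of_mem (f := cdel hT) (ih _ e')
    rw [Submodule.map_span] at this
    refine Submodule.span_mono ?_ this
    rintro _ ⟨_, ⟨d, e'', rfl⟩, rfl⟩
    exact ⟨d, cdel hT e'', (push_cdel _ _ _).symm⟩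

lemma EX.eq_zero_of_smul_top_eq (I : Ideal R) (hD : I • (⊤ : Submodule R D) = ⊤) (M : ModuleCat.{0} R) (n : ℕ)
    (X : ModuleCat.{0} R) [Module.Finite R X] (hX : ∀ r ∈ I, ∀ x : X, r • x = 0)
    (e : EX X (ModuleCat.of R (M ⊗[R] D)) n) : e = 0 := by
  have := EX.mem_span_tmul M n X e
  refine (Submodule.mem_bot R).1 (Submodule.span_le.2 ?_ this)
  rintro _ ⟨d, e', rfl⟩
  have hd : d ∈ I • (⊤ : Submodule R D) := by rw [hD]; trivial
  show push (tmulHom M d) e' = 0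
  induction hd using Submodule.smul_induction_on' with
  | smul r hr d _ =>
    have : tmulHom M (r • d) = r • tmulHom M d := by ext; simp [tmulHom]
    rw [this, push_smul]
    exact smul_eq_zero_of_left (hX r hr) _
  | add a _ b _ ha hb =>
    have : tmulHom M (a + b) = tmulHom M a + tmulHom M b := by ext; simp [tmulHom]
    rw [this, push_add, ha, hb, add_zero]

end flat

section
open TensorProduct
variable (R S : Type) [CommRing R] [CommRing S] [Algebra R S]

/-- the cokernel of `R → S` -/
abbrev AlgCoker : Type := S ⧸ LinearMap.range (Algebra.linearMap R S)

lemma exact_algCoker (M : Type) [AddCommGroup M] [Module R M] :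
    Function.Exact ((TensorProduct.mk R M S).flip 1) ((LinearMap.range (Algebra.linearMap R S)).mkQ.lTensor M) := by
  have h1 : Function.Exact (Algebra.linearMap R S) (LinearMap.range (Algebra.linearMap R S)).mkQ := by
    rw [LinearMap.exact_iff, Submodule.ker_mkQ]
  have h2 := lTensor_exact M h1 (Submodule.mkQ_surjective _)
  intro x
  rw [h2 x]
  constructor
  · rintro ⟨y, rfl⟩
    obtain ⟨m, rfl⟩ := (TensorProduct.rid R M).symm.surjective y
    exact ⟨m, by simp⟩
  · rintro ⟨m, rfl⟩
    exact ⟨m ⊗ₜ 1, by simp⟩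

variable [Module.FaithfullyFlat R S]

lemma tmul_one_injective (M : Type) [AddCommGroup M] [Module R M] :
    Function.Injective ((TensorProduct.mk R M S).flip 1) := by
  intro a b h
  apply Module.FaithfullyFlat.tensorProduct_mk_injective (A := R) (B := S) M
  have := congrArg (TensorProduct.comm R M S) h
  simpa using this

instance flat_algCoker : Module.Flat R (AlgCoker R S) := by
  rw [Module.Flat.iff_rTensor_preserves_injective_linearMap]
  intro N P _ _ _ _ f hf
  rw [injective_iff_map_eq_zero]
  intro x hx
  let q := (LinearMap.range (Algebra.linearMap R S)).mkQ
  have hq : Function.Surjective q := Submodule.mkQ_surjective _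
  obtain ⟨y, rfl⟩ := LinearMap.lTensor_surjective N hq x
  have h1 : q.lTensor P (f.rTensor S y) = 0 := by
    rw [← hx]
    simp only [← LinearMap.comp_apply, LinearMap.lTensor_comp_rTensor, LinearMap.rTensor_comp_lTensor]
  obtain ⟨p, hp⟩ := (exact_algCoker R S P _).1 h1
  have hpf : p ∈ LinearMap.range f := by
    rw [← Submodule.ker_mkQ (LinearMap.range f)]
    apply tmul_one_injective R S (P ⧸ LinearMap.range f)
    have := congrArg ((LinearMap.range f).mkQ.rTensor S) hp
    have h3 : (LinearMap.range f).mkQ.rTensor S (f.rTensor S y) = 0 := by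
      rw [← LinearMap.comp_apply, ← LinearMap.rTensor_comp, LinearMap.range_mkQ_comp]; simp
    rw [h3] at this
    simpa using this
  obtain ⟨n, rfl⟩ := hpf
  have hy : y = n ⊗ₜ 1 := by
    apply Module.Flat.rTensor_preserves_injective_linearMap (M := S) f hf
    rw [← hp]
    simp
  rw [hy]
  exact (exact_algCoker R S N _).2 ⟨n, rfl⟩

/-- the sequence `0 → M → M ⊗ S → M ⊗ (S / R) → 0` -/
noncomputable def algCokerSES (M : ModuleCat.{0} R) : ShortComplex (ModuleCat.{0} R) :=
  ShortComplex.mk (X₂ := ModuleCat.of R (M ⊗[R] S)) (X₃ := ModuleCat.of R (M ⊗[R] AlgCoker R S))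
   (ModuleCat.ofHom ((TensorProduct.mk R M S).flip 1))
   (ModuleCat.ofHom ((LinearMap.range (Algebra.linearMap R S)).mkQ.lTensor M))
   (by ext x; exact (exact_algCoker R S M).apply_apply_eq_zero x)

lemma algCokerSES_exact (M : ModuleCat.{0} R) : (algCokerSES R S M).ShortExact where
  exact := (ShortComplex.ShortExact.moduleCat_exact_iff_function_exact _).2 (exact_algCoker R S M)
  mono_f := by rw [ModuleCat.mono_iff_injective]; exact tmul_one_injective R S M
  epi_g := by
    rw [ModuleCat.epi_iff_surjective]
    exact LinearMap.lTensor_surjective M (Submodule.mkQ_surjective _)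

lemma EX.push_tmul_one_bijective [IsNoetherianRing R] (I : Ideal R) (hI : I • (⊤ : Submodule R (AlgCoker R S)) = ⊤)
    (M : ModuleCat.{0} R) (n : ℕ)
    (X : ModuleCat.{0} R) [Module.Finite R X] (hX : ∀ r ∈ I, ∀ x : X, r • x = 0) :
    Function.Bijective (push (A := X) (i := n) (algCokerSES R S M).f) := by
  have hT := algCokerSES_exact R S M
  have h0 : ∀ i (e : EX X (algCokerSES R S M).X₃ i), e = 0 := fun i e =>
    EX.eq_zero_of_smul_top_eq I hI M i X hX e
  constructor
  · cases n with
    | zero => exact push_f_injective hT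
    | succ n =>
      rw [injective_iff_map_eq_zero]
      intro e he
      obtain ⟨e', rfl⟩ := exact₁ hT e he
      rw [h0 _ e', map_zero]
  · intro e
    exact exact₂ hT e (h0 _ _)

end

lemma EX.push_bijective_of_iso {R : Type} [CommRing R] {X N N' : ModuleCat.{0} R} {n : ℕ} (f : N ≅ N') :
    Function.Bijective (push (A := X) (i := n) f.hom) := by
  refine Function.bijective_iff_has_inverse.2 ⟨push f.inv, fun e => ?_, fun e => ?_⟩
  · rw [push_push, Iso.hom_inv_id, push_id]
  · rw [push_push, Iso.inv_hom_id, push_id]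

theorem IsExtColim.of_push {R : Type} [CommRing R] {I : Ideal R} {N N' : ModuleCat.{0} R} {i : ℕ} {H : Type}
    [AddCommGroup H] [Module R H] {ι} (h : IsExtColim I N' i H ι) (j : N ⟶ N')
    (hj : ∀ t, Function.Bijective (EX.push (A := ModuleCat.of R (R ⧸ I ^ t)) (i := i) j)) :
    ∃ ι', IsExtColim I N i H ι' := by
  refine ⟨fun t => ι t ∘ₗ EX.push j, ?_, ?_, ?_⟩
  · intro t s hts e
    have : EX.push j (_root_.res I hts e) = _root_.res I hts (EX.push j e) :=
      (EX.pull_push _ _ _).symm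
    rw [LinearMap.comp_apply, this, h.res, LinearMap.comp_apply]
  · intro x
    obtain ⟨t, e, rfl⟩ := h.surj x
    obtain ⟨e, rfl⟩ := (hj t).2 e
    exact ⟨t, e, rfl⟩
  · intro t e he
    obtain ⟨s, hs, h0⟩ := h.zero t _ he
    refine ⟨s, hs, (hj s).1 ?_⟩
    rw [map_zero, ← h0]
    exact (EX.pull_push _ _ _).symm

/-- an additive equivalence which is semilinear gives an isomorphism after restriction of scalars -/
noncomputable def restrictIso {R S : Type} [CommRing R] [CommRing S] {f : R →+* S} {A : ModuleCat.{0} R} {B : ModuleCat.{0} S}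
    (e : A ≃+ B) (h : ∀ (r : R) (a : A), e (r • a) = f r • e a) : A ≅ (ModuleCat.restrictScalars f).obj B :=
  have hb : IsIso (ModuleCat.ofHom (X := A) (Y := (ModuleCat.restrictScalars f).obj B)
      { toFun := e, map_add' := map_add e, map_smul' := h } : A ⟶ (ModuleCat.restrictScalars f).obj B) := by
    rw [ConcreteCategory.isIso_iff_bijective]
    exact e.bijective
  @asIso _ _ _ _ _ hb

section completion
open IsLocalRing
variable {R : Type} [CommRing R] [IsNoetherianRing R] [IsLocalRing R]

instance faithfullyFlat_adicCompletion : Module.FaithfullyFlat R (AdicCompletion (maximalIdeal R) R) :=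
  Module.FaithfullyFlat.of_flat_of_isLocalHom

lemma smul_algCoker_adicCompletion (t : ℕ) :
    (maximalIdeal R) ^ t • (⊤ : Submodule R (AlgCoker R (AdicCompletion (maximalIdeal R) R))) = ⊤ := by
  rw [eq_top_iff]
  rintro x -
  obtain ⟨x, rfl⟩ := Submodule.mkQ_surjective _ x
  obtain ⟨r, hr⟩ := Submodule.mkQ_surjective _ (AdicCompletion.eval (maximalIdeal R) R t x)
  have h1 : x - algebraMap R _ r ∈ (AdicCompletion.eval (maximalIdeal R) R t).ker := by
    rw [LinearMap.mem_ker, map_sub, ← hr]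
    exact sub_self _
  rw [← AdicCompletion.pow_smul_top_eq_ker_eval (maximalIdeal R).fg_of_isNoetherianRing] at h1
  have h2 : Submodule.mkQ (LinearMap.range (Algebra.linearMap R (AdicCompletion (maximalIdeal R) R))) x =
     Submodule.mkQ _ (x - algebraMap R _ r) := by
    rw [map_sub, sub_eq_self.2]
    rw [Submodule.mkQ_apply, Submodule.Quotient.mk_eq_zero]
    exact ⟨r, rfl⟩
  rw [h2]
  have := Submodule.mem_map_of_mem (f := Submodule.mkQ (LinearMap.range (Algebra.linearMap R (AdicCompletion (maximalIdeal R) R)))) h1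
  rw [Submodule.map_smul''] at this
  exact Submodule.smul_mono le_rfl le_top this

/-- local cohomology of the completion as a colimit of `Ext` groups over the original ring -/
theorem isExtColim_completion (M : ModuleCat.{0} R) [Module.Finite R M] (n : ℕ)
    [Module R ((localCohomology ((maximalIdeal R).map (algebraMap R (AdicCompletion (maximalIdeal R) R))) (n+1)).obj
       (ModuleCat.of (AdicCompletion (maximalIdeal R) R) (AdicCompletion (maximalIdeal R) M)))]
    (hRS : ∀ (r : R) (h : ((localCohomology ((maximalIdeal R).map (algebraMap R (AdicCompletion (maximalIdeal R) R))) (n+1)).obj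
       (ModuleCat.of (AdicCompletion (maximalIdeal R) R) (AdicCompletion (maximalIdeal R) M)))), r • h = (algebraMap R (AdicCompletion (maximalIdeal R) R)) r • h) :
    ∃ ι, IsExtColim (maximalIdeal R) M (n+1) ((localCohomology ((maximalIdeal R).map (algebraMap R (AdicCompletion (maximalIdeal R) R))) (n+1)).obj
       (ModuleCat.of (AdicCompletion (maximalIdeal R) R) (AdicCompletion (maximalIdeal R) M))) ι := by
  obtain ⟨ι, hι⟩ := LC_isExtColim ((maximalIdeal R).map (algebraMap R (AdicCompletion (maximalIdeal R) R)))
    (ModuleCat.of (AdicCompletion (maximalIdeal R) R) (AdicCompletion (maximalIdeal R) M)) n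
  have hf : (algebraMap R (AdicCompletion (maximalIdeal R) R)).Flat := by
    rw [RingHom.flat_algebraMap_iff]; infer_instance
  obtain ⟨ι', hι'⟩ := hι.restrict hf hRS
  let e := restrictIso (f := algebraMap R (AdicCompletion (maximalIdeal R) R))
    (A := ModuleCat.of R (TensorProduct R M (AdicCompletion (maximalIdeal R) R)))
    (B := ModuleCat.of (AdicCompletion (maximalIdeal R) R) (AdicCompletion (maximalIdeal R) M))
    ((TensorProduct.comm R _ _).toAddEquiv.trans (AdicCompletion.ofTensorProductEquivOfFiniteNoetherian (maximalIdeal R) M).toAddEquiv) (by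
        intro r x
        have : (AdicCompletion.ofTensorProductEquivOfFiniteNoetherian (maximalIdeal R) M) (TensorProduct.comm R _ _ (r • x)) =
          (algebraMap R (AdicCompletion (maximalIdeal R) R)) r • (AdicCompletion.ofTensorProductEquivOfFiniteNoetherian (maximalIdeal R) M) (TensorProduct.comm R _ _ x) := by
          rw [map_smul, algebraMap_smul]
          exact LinearMap.map_smul_of_tower (AdicCompletion.ofTensorProductEquivOfFiniteNoetherian (maximalIdeal R) M).toLinearMap r _
        exact this)
  refine hι'.of_push ((algCokerSES R _ M).f ≫ e.hom) fun t => ?_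
  have h1 := EX.push_tmul_one_bijective R (AdicCompletion (maximalIdeal R) R) ((maximalIdeal R) ^ t) (smul_algCoker_adicCompletion t) M (n+1)
    (ModuleCat.of R (R ⧸ (maximalIdeal R) ^ t)) ?_
  · have h2 := (EX.push_bijective_of_iso (X := ModuleCat.of R (R ⧸ (maximalIdeal R) ^ t)) (n := n+1) e).comp h1
    have h3 : ⇑(EX.push (A := ModuleCat.of R (R ⧸ (maximalIdeal R) ^ t)) (i := n+1)
        ((algCokerSES R (AdicCompletion (maximalIdeal R) R) M).f ≫ e.hom)) =
        EX.push e.hom ∘ EX.push (algCokerSES R (AdicCompletion (maximalIdeal R) R) M).f :=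
      funext fun x => (EX.push_push _ _ _).symm
    rw [← h3] at h2
    exact h2
  · intro r hr x
    obtain ⟨x, rfl⟩ := Ideal.Quotient.mk_surjective x
    refine Eq.trans ?_ (Ideal.Quotient.eq_zero_iff_mem.2 (Ideal.mul_mem_right x _ hr))
    rfl

end completion

namespace EX
variable {R : Type} [CommRing R] {i : ℕ}

lemma pull_cdel {N : ModuleCat.{0} R} {S T : ShortComplex (ModuleCat.{0} R)} (hS : S.ShortExact) (hT : T.ShortExact) (φ : S ⟶ T)
    (e : EX T.X₁ N i) : pull φ.τ₃ (cdel hT e) = cdel hS (pull φ.τ₁ e) := by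
  dsimp only [push, pull, del, cdel, LinearMap.coe_mk, AddHom.coe_mk]
  rw [← Abelian.Ext.comp_assoc _ _ _ (zero_add 1) _ (by lia), ← Abelian.Ext.comp_assoc _ _ _ (add_zero 1) _ (by lia),
    ShortComplex.ShortExact.extClass_naturality hS hT φ]

end EX

/-- the short exact sequence of a surjection -/
noncomputable def kerSES {R : Type} [CommRing R] {F X : ModuleCat.{0} R} (π : F ⟶ X) : ShortComplex (ModuleCat.{0} R) :=
  ShortComplex.mk (ModuleCat.ofHom (LinearMap.ker π.hom).subtype) π (by ext; simp)

lemma kerSES_exact {R : Type} [CommRing R] {F X : ModuleCat.{0} R} (π : F ⟶ X) (hπ : Function.Surjective π.hom) :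
    (kerSES π).ShortExact where
  exact := (ShortComplex.ShortExact.moduleCat_exact_iff_function_exact _).2 (LinearMap.exact_subtype_ker_map π.hom)
  mono_f := by rw [ModuleCat.mono_iff_injective]; exact Subtype.val_injective
  epi_g := by rw [ModuleCat.epi_iff_surjective]; exact hπ

/-- morphism of kernel sequences induced by a square -/
noncomputable def kerSESHom {R : Type} [CommRing R] {F X F' X' : ModuleCat.{0} R} {π : F ⟶ X} {π' : F' ⟶ X'} (a : F ⟶ F') (b : X ⟶ X')
    (h : a ≫ π' = π ≫ b) : kerSES π ⟶ kerSES π' where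
  τ₁ := ModuleCat.ofHom (LinearMap.restrict a.hom (fun x hx => by
    have := LinearMap.congr_fun (congrArg ModuleCat.Hom.hom h) x
    simp only [ModuleCat.hom_comp, LinearMap.comp_apply, LinearMap.mem_ker.1 hx, map_zero] at this
    exact LinearMap.mem_ker.2 this))
  τ₂ := a
  τ₃ := b
  comm₁₂ := rfl
  comm₂₃ := h

section torsion
variable {R : Type} [CommRing R] [IsNoetherianRing R] (I : Ideal R)

/-- inclusion of `I ^ s X` -/
noncomputable def powSub (X : ModuleCat.{0} R) (s : ℕ) : ModuleCat.of R (I ^ s • ⊤ : Submodule R X) ⟶ X :=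
  ModuleCat.ofHom (Submodule.subtype _)

lemma EX.exists_pull_powSub_eq_zero (N : ModuleCat.{0} R) (hN : ∀ x : N, ∃ k, ∀ r ∈ I ^ k, r • x = 0)
    (i : ℕ) (X : ModuleCat.{0} R) [Module.Finite R X] (e : EX X N i) : ∃ s, pull (powSub I X s) e = 0 := by
  induction i generalizing X with
  | zero =>
    obtain ⟨f, rfl⟩ := exists_mk₀ e
    obtain ⟨G, hG⟩ := Module.Finite.fg_top (R := R) (M := X)
    choose k hk using fun x : X => hN (f.hom x)
    refine ⟨G.sup k, ?_⟩
    rw [pull_mk₀, ← Abelian.Ext.mk₀_zero]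
    congr 1
    ext ⟨x, hx⟩
    show f.hom x = 0
    induction hx using Submodule.smul_induction_on' with
    | smul r hr x h_top =>
      clear h_top
      have : x ∈ Submodule.span R (G : Set X) := by rw [hG]; trivial
      rw [map_smul]
      induction this using Submodule.span_induction with
      | mem x hx => exact hk x r (Ideal.pow_le_pow_right (Finset.le_sup hx) hr)
      | zero => simp
      | add a b _ _ ha hb => rw [map_add, smul_add, ha, hb, add_zero]
      | smul c a _ ha => rw [map_smul, smul_comm, ha, smul_zero]
    | add a _ b _ ha hb => rw [map_add, ha, hb, add_zero]
  | succ i ih =>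
    obtain ⟨n, π, hπ⟩ := Module.Finite.exists_fin' R X
    let F := ModuleCat.of R (Fin n → R)
    let π' : F ⟶ X := ModuleCat.ofHom π
    have hT := kerSES_exact π' hπ
    obtain ⟨e', rfl⟩ := cexact₃ hT e (eq_zero_of_proj (inferInstanceAs (Module.Projective R (Fin n → R))) _)
    let K := ModuleCat.of R (LinearMap.ker π)
    have : Module.Finite R K := inferInstanceAs (Module.Finite R (LinearMap.ker π))
    obtain ⟨k, hk⟩ := ih K e'
    obtain ⟨c, hc⟩ := I.exists_pow_inf_eq_pow_smul (LinearMap.ker π)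
    let s := k + c
    have hle : (I ^ s • ⊤ : Submodule R (Fin n → R)) ≤ (I ^ s • ⊤ : Submodule R X).comap π := by
      rw [← Submodule.map_le_iff_le_comap, Submodule.map_smul'']
      exact Submodule.smul_mono le_rfl le_top
    let πs : ModuleCat.of R (I ^ s • ⊤ : Submodule R F) ⟶ ModuleCat.of R (I ^ s • ⊤ : Submodule R X) :=
      ModuleCat.ofHom (π.restrict hle)
    have hπs : Function.Surjective πs.hom := by
      rintro ⟨x, hx⟩
      have : x ∈ (I ^ s • ⊤ : Submodule R (Fin n → R)).map π := by
        rw [Submodule.map_smul'', Submodule.map_top, LinearMap.range_eq_top.2 hπ]; exact hx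
      obtain ⟨y, hy, rfl⟩ := this
      exact ⟨⟨y, hy⟩, rfl⟩
    have hTs := kerSES_exact πs hπs
    refine ⟨s, ?_⟩
    have := pull_cdel hTs hT (kerSESHom (π := πs) (π' := π') (powSub I F s) (powSub I X s) rfl) e'
    refine this.trans ?_
    let b : (kerSES πs).X₁ ⟶ ModuleCat.of R (I ^ k • ⊤ : Submodule R K) :=
      ModuleCat.ofHom (LinearMap.codRestrict _ ((kerSESHom (π := πs) (π' := π') (powSub I F s) (powSub I X s) rfl).τ₁.hom) (by
        rintro ⟨⟨x, hx⟩, hx'⟩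
        have hx' : x ∈ LinearMap.ker π := by
          have := congrArg Subtype.val (LinearMap.mem_ker.1 hx')
          exact this
        have h1 : x ∈ (I ^ s • ⊤ ⊓ LinearMap.ker π : Submodule R (Fin n → R)) := ⟨hx, hx'⟩
        rw [hc s (Nat.le_add_left _ _), show s - c = k by simp [s]] at h1
        have h2 : x ∈ (I ^ k • ⊤ : Submodule R (LinearMap.ker π)).map (LinearMap.ker π).subtype := by
          rw [Submodule.map_smul'', Submodule.map_top, Submodule.range_subtype]
          exact Submodule.smul_mono le_rfl inf_le_right h1
        obtain ⟨y, hy, hyx⟩ := h2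
        have : y = ⟨x, hx'⟩ := Subtype.ext hyx
        rw [this] at hy
        exact hy))
    have hb : (kerSESHom (π := πs) (π' := π') (powSub I F s) (powSub I X s) rfl).τ₁ = b ≫ powSub I K k := rfl
    rw [hb]
    have := pull_pull (powSub I K k) b e'
    refine (congrArg _ (this.symm.trans ((congrArg _ hk).trans (map_zero _)))).trans (map_zero _)

end torsion

/-- vanishing of the colimit of `Ext (R ⧸ I ^ t, N)` -/
def ExtVanish {R : Type} [CommRing R] (I : Ideal R) (N : ModuleCat.{0} R) (i : ℕ) : Prop :=
  ∀ (t : ℕ) (e : EX (ModuleCat.of R (R ⧸ I ^ t)) N i), ∃ (s : ℕ) (h : t ≤ s), res I h e = 0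

lemma ExtVanish.of_torsion {R : Type} [CommRing R] [IsNoetherianRing R] {I : Ideal R} {N : ModuleCat.{0} R}
    (hN : ∀ x : N, ∃ k, ∀ r ∈ I ^ k, r • x = 0) (i : ℕ) : ExtVanish I N (i+1) := by
  intro t e
  let q : ∀ t : ℕ, ModuleCat.of R R ⟶ ModuleCat.of R (R ⧸ I ^ t) := fun t => ModuleCat.ofHom (Submodule.mkQ (I ^ t))
  have hq : ∀ t, Function.Surjective (q t).hom := fun t => Submodule.mkQ_surjective _
  have hT := fun t => kerSES_exact (q t) (hq t)
  obtain ⟨e', rfl⟩ := EX.cexact₃ (hT t) e (EX.eq_zero_of_proj (inferInstanceAs (Module.Projective R R)) _)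
  let K := (kerSES (q t)).X₁
  have : Module.Finite R K := inferInstanceAs (Module.Finite R (LinearMap.ker (Submodule.mkQ (I ^ t))))
  obtain ⟨k, hk⟩ := EX.exists_pull_powSub_eq_zero I N hN i K e'
  refine ⟨k + t, Nat.le_add_left _ _, ?_⟩
  let φ := kerSESHom (π := q (k+t)) (π' := q t) (𝟙 _) (powHom I (Nat.le_add_left t k)) rfl
  refine (EX.pull_cdel (hT (k+t)) (hT t) φ e').trans ?_
  let b : (kerSES (q (k+t))).X₁ ⟶ ModuleCat.of R (I ^ k • ⊤ : Submodule R K) :=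
      ModuleCat.ofHom (LinearMap.codRestrict _ φ.τ₁.hom (by
        rintro ⟨x, hx⟩
        have hx' : x ∈ I ^ (k + t) := by
          rw [← Submodule.ker_mkQ (I ^ (k+t))]; exact hx
        have h2 : x ∈ (I ^ k • ⊤ : Submodule R (LinearMap.ker (Submodule.mkQ (I ^ t)))).map (Submodule.subtype _) := by
          rw [Submodule.map_smul'', Submodule.map_top, Submodule.range_subtype, Submodule.ker_mkQ, smul_eq_mul, ← pow_add]
          exact hx'
        obtain ⟨y, hy, hyx⟩ := h2
        have : y = φ.τ₁.hom ⟨x, hx⟩ := Subtype.ext hyx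
        rw [this] at hy
        exact hy))
  have hb : φ.τ₁ = b ≫ powSub I K k := rfl
  rw [hb]
  have := EX.pull_pull (powSub I K k) b e'
  refine (congrArg _ (this.symm.trans ((congrArg _ hk).trans (map_zero _)))).trans (map_zero _)

section res
variable {R : Type} [CommRing R] (J : Ideal R) {N N' : ModuleCat.{0} R} {i : ℕ}

lemma res_res {t s u : ℕ} (h : t ≤ s) (h' : s ≤ u) (e : EX (ModuleCat.of R (R ⧸ J ^ t)) N i) :
    res J h' (res J h e) = res J (h.trans h') e := by
  rw [res_eq, res_eq, res_eq, EX.pull_pull]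
  have : powHom J h' ≫ powHom J h = powHom J (h.trans h') := by
    ext
    rfl
  rw [this]

lemma res_push {t s : ℕ} (h : t ≤ s) (f : N ⟶ N') (e : EX (ModuleCat.of R (R ⧸ J ^ t)) N i) :
    res J h (EX.push f e) = EX.push f (res J h e) := EX.pull_push _ _ _

lemma res_del {S : ShortComplex (ModuleCat.{0} R)} (hS : S.ShortExact) {t s : ℕ} (h : t ≤ s)
    (e : EX (ModuleCat.of R (R ⧸ J ^ t)) S.X₃ i) :
    res J h (EX.del hS e) = EX.del hS (res J h e) := EX.pull_del _ _ _

lemma res_sub {t s : ℕ} (h : t ≤ s) (e e' : EX (ModuleCat.of R (R ⧸ J ^ t)) N i) :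
    res J h (e - e') = res J h e - res J h e' := map_sub (EX.pull _) _ _

lemma res_smul {t s : ℕ} (h : t ≤ s) (r : R) (e : EX (ModuleCat.of R (R ⧸ J ^ t)) N i) :
    res J h (r • e) = r • res J h e := map_smul (EX.pull _) _ _

end res

lemma ExtVanish.of_ses {R : Type} [CommRing R] {I : Ideal R} {i : ℕ} {S : ShortComplex (ModuleCat.{0} R)}
    (hS : S.ShortExact) (h₁ : ExtVanish I S.X₁ i) (h₃ : ExtVanish I S.X₃ i) : ExtVanish I S.X₂ i := by
  intro t e
  obtain ⟨s, h, hs⟩ := h₃ t (EX.push S.g e)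
  rw [res_push] at hs
  obtain ⟨e', he'⟩ := EX.exact₂ hS _ hs
  obtain ⟨u, h', hu⟩ := h₁ s e'
  refine ⟨u, h.trans h', ?_⟩
  rw [← res_res I h h', ← he', res_push, hu, map_zero]

theorem extVanish_of_supportDim_le {R : Type} [CommRing R] [IsNoetherianRing R] [IsLocalRing R] (i : ℕ)
    (N : Type) [AddCommGroup N] [Module R N] [hN : Module.Finite R N] (h : Module.supportDim R N ≤ (i : ℕ)) :
    ExtVanish (IsLocalRing.maximalIdeal R) (ModuleCat.of R N) (i+1) := by
  induction i using Nat.strong_induction_on generalizing N with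
  | _ i ih =>
  revert h
  refine IsNoetherianRing.induction_on_isQuotientEquivQuotientPrime R hN
    (motive := fun N _ _ _ => Module.supportDim R N ≤ (i : ℕ) →
      ExtVanish (IsLocalRing.maximalIdeal R) (ModuleCat.of R N) (i+1)) ?_ ?_ ?_
  · intro N _ _ _ _ _
    refine ExtVanish.of_torsion (fun x => ⟨0, fun r _ => Subsingleton.elim (α := N) _ _⟩) i
  · intro N _ _ _ q e h
    by_cases hq : IsLocalRing.maximalIdeal R ≤ q.1
    · refine ExtVanish.of_torsion (fun x => ⟨1, fun r hr => ?_⟩) i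
      apply e.injective
      obtain ⟨y, hy⟩ := Ideal.Quotient.mk_surjective (e x)
      rw [map_smul, map_zero, ← hy, Algebra.smul_def, Ideal.Quotient.algebraMap_eq, ← map_mul,
        Ideal.Quotient.eq_zero_iff_mem]
      exact Ideal.mul_mem_right _ _ (hq (by simpa using hr))
    · obtain ⟨x, hx, hxq⟩ := Set.not_subset.1 hq
      intro t c
      have hreg : IsSMulRegular N (x ^ (t+1)) := by
        apply IsSMulRegular.pow
        rw [e.isSMulRegular_congr x]
        intro a b hab
        obtain ⟨a, rfl⟩ := Ideal.Quotient.mk_surjective a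
        obtain ⟨b, rfl⟩ := Ideal.Quotient.mk_surjective b
        simp only [Algebra.smul_def, Ideal.Quotient.algebraMap_eq, ← map_mul] at hab
        rw [Ideal.Quotient.eq, ← mul_sub] at hab
        exact Ideal.Quotient.eq.2 ((q.2.mem_or_mem hab).resolve_left hxq)
      have hd := Module.supportDim_quotSMulTop_succ_eq_supportDim hreg (Ideal.pow_mem_of_mem _ hx _ (Nat.succ_pos t))
      have hS : (ModuleCat.smulShortComplex (ModuleCat.of R N) (x ^ (t+1))).ShortExact :=
        IsSMulRegular.smulShortComplex_shortExact (M := ModuleCat.of R N) hreg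
      have hc : (x ^ (t+1)) • c = 0 := EX.smul_eq_zero_of_left (fun a => by
        obtain ⟨a, rfl⟩ := Ideal.Quotient.mk_surjective a
        show (x ^ (t+1)) • Ideal.Quotient.mk _ a = 0
        rw [Algebra.smul_def, Ideal.Quotient.algebraMap_eq, ← map_mul, Ideal.Quotient.eq_zero_iff_mem]
        exact Ideal.mul_mem_right _ _ (Ideal.pow_le_pow_right t.le_succ (Ideal.pow_mem_pow hx _))) c
      rw [← EX.push_smul_id] at hc
      obtain ⟨c', hc'⟩ := EX.exact₁ hS c hc
      rcases i with _ | i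
      · by_cases hb : Module.supportDim R (QuotSMulTop (x ^ (t+1)) N) = ⊥
        · rw [hb, WithBot.bot_add, eq_comm, Module.supportDim_eq_bot_iff_subsingleton] at hd
          exact ExtVanish.of_torsion (fun x => ⟨0, fun r _ => Subsingleton.elim (α := N) _ _⟩) 0 t c
        · exfalso
          obtain ⟨n, hn⟩ := WithBot.ne_bot_iff_exists.1 hb
          rw [← hn] at hd
          rw [← hd] at h
          have h : ((n + 1 : ℕ∞) : WithBot ℕ∞) ≤ ((0 : ℕ∞) : WithBot ℕ∞) := h
          rw [WithBot.coe_le_coe] at h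
          simp at h
      · have h1 : Module.supportDim R (QuotSMulTop (x ^ (t+1)) N) ≤ (i : ℕ) := by
          by_cases hb : Module.supportDim R (QuotSMulTop (x ^ (t+1)) N) = ⊥
          · rw [hb]; exact bot_le
          · obtain ⟨n, hn⟩ := WithBot.ne_bot_iff_exists.1 hb
            rw [← hn] at hd ⊢
            rw [← hd] at h
            have h : ((n + 1 : ℕ∞) : WithBot ℕ∞) ≤ ((i + 1 : ℕ∞) : WithBot ℕ∞) := by exact_mod_cast h
            rw [WithBot.coe_le_coe] at h
            have : n ≤ (i : ℕ∞) := (ENat.add_le_add_iff_right (by simp)).1 h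
            exact_mod_cast this
        obtain ⟨s, hs, h0⟩ := ih i (Nat.lt_succ_self i) (QuotSMulTop (x ^ (t+1)) N) h1 t c'
        refine ⟨s, hs, ?_⟩
        rw [← hc']
        refine (res_del _ hS hs c').trans ?_
        exact (congrArg _ h0).trans (map_zero _)
  · intro N₁ _ _ _ N₂ _ _ _ N₃ _ _ _ f g hf hg hfg h1 h3 h
    let S := ShortComplex.mk (ModuleCat.ofHom f) (ModuleCat.ofHom g) (by
      ext a; exact hfg.apply_apply_eq_zero a)
    have hS : S.ShortExact :=
      { exact := (ShortComplex.ShortExact.moduleCat_exact_iff_function_exact _).2 hfg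
        mono_f := by rw [ModuleCat.mono_iff_injective]; exact hf
        epi_g := by rw [ModuleCat.epi_iff_surjective]; exact hg }
    exact ExtVanish.of_ses hS (h1 ((Module.supportDim_le_of_injective f hf).trans h))
      (h3 ((Module.supportDim_le_of_surjective g hg).trans h))

section divisible
variable {R : Type} [CommRing R] {J : Ideal R}

/-- multiplication by `y` onto its image -/
noncomputable def mulOnto (N : ModuleCat.{0} R) (y : R) : N ⟶ ModuleCat.of R (y • ⊤ : Submodule R N) :=
  ModuleCat.ofHom (LinearMap.codRestrict _ (LinearMap.lsmul R N y)
    (fun x => Submodule.smul_mem_pointwise_smul x y ⊤ trivial))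

/-- the sequence `0 → y N → N → N / y N → 0` -/
noncomputable def smulTopSES (N : ModuleCat.{0} R) (y : R) : ShortComplex (ModuleCat.{0} R) :=
  ShortComplex.mk (ModuleCat.ofHom (y • ⊤ : Submodule R N).subtype)
    (ModuleCat.ofHom (y • ⊤ : Submodule R N).mkQ) (by ext x; exact (Submodule.Quotient.mk_eq_zero _).2 x.2)

lemma smulTopSES_exact (N : ModuleCat.{0} R) (y : R) : (smulTopSES N y).ShortExact where
  exact := (ShortComplex.ShortExact.moduleCat_exact_iff_function_exact _).2
    (LinearMap.exact_subtype_mkQ (y • ⊤ : Submodule R N))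
  mono_f := by rw [ModuleCat.mono_iff_injective]; exact Subtype.val_injective
  epi_g := by rw [ModuleCat.epi_iff_surjective]; exact Submodule.mkQ_surjective _

lemma ExtVanish.exists_res_eq_smul {N : ModuleCat.{0} R} {y : R} {i : ℕ}
    (h₁ : ExtVanish J (ModuleCat.of R (QuotSMulTop y N)) i)
    (h₂ : ExtVanish J (ModuleCat.of R (LinearMap.ker (mulOnto N y).hom)) (i+1))
    (t : ℕ) (b : EX (ModuleCat.of R (R ⧸ J ^ t)) N i) :
    ∃ (s : ℕ) (h : t ≤ s) (b' : EX (ModuleCat.of R (R ⧸ J ^ s)) N i), res J h b = y • b' := by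
  obtain ⟨s, h, hs⟩ := h₁ t (EX.push (smulTopSES N y).g b)
  have hs := (res_push J h (N := N) (smulTopSES N y).g b).symm.trans hs
  obtain ⟨c, hc⟩ := EX.exact₂ (smulTopSES_exact N y) _ hs
  have hK : (kerSES (mulOnto N y)).ShortExact := kerSES_exact _ (by
    rintro ⟨x, hx⟩
    obtain ⟨z, -, rfl⟩ := hx
    exact ⟨z, rfl⟩)
  obtain ⟨u, h', hu⟩ := h₂ s (EX.del hK c)
  have hu := (res_del J hK h' c).symm.trans hu
  obtain ⟨b', hb'⟩ := EX.exact₃ hK _ hu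
  refine ⟨u, h.trans h', b', ?_⟩
  have h1 : res J h b = EX.push (N' := N) (smulTopSES N y).f c := hc.symm
  rw [← res_res J h h', h1]
  refine Eq.trans ?_ (EX.push_smul_id y _)
  refine (res_push J h' _ _).trans ?_
  refine (congrArg _ hb'.symm).trans ?_
  exact EX.push_push _ _ _

variable {M : ModuleCat.{0} R} {x y : R} {n : ℕ}

/-- the module `M / x M` as the cokernel in `ModuleCat` -/
noncomputable abbrev Mbar (M : ModuleCat.{0} R) (x : R) : ModuleCat.{0} R := ModuleCat.of R (QuotSMulTop x M)

/-- connecting map for `0 → M → M → M / x M → 0` -/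
noncomputable def delQuot (hx : IsSMulRegular M x) {A : ModuleCat.{0} R} : EX A (Mbar M x) n →ₗ[R] EX A M (n+1) :=
  EX.del hx.smulShortComplex_shortExact

/-- the map to `Ext` with coefficients `M / x M` -/
noncomputable def toQuot (x : R) {A : ModuleCat.{0} R} : EX A M n →ₗ[R] EX A (Mbar M x) n :=
  EX.push (ModuleCat.smulShortComplex M x).g

lemma res_delQuot (hx : IsSMulRegular M x) {t s : ℕ} (h : t ≤ s) (b : EX (ModuleCat.of R (R ⧸ J ^ t)) (Mbar M x) n) :
    res J h (delQuot hx b) = delQuot hx (res J h b) := res_del J _ _ _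

lemma res_toQuot {t s : ℕ} (h : t ≤ s) (b : EX (ModuleCat.of R (R ⧸ J ^ t)) M n) :
    res J h (toQuot x b) = toQuot x (res J h b) := res_push J _ _ _

lemma smul_delQuot (hx : IsSMulRegular M x) {A : ModuleCat.{0} R} (b : EX A (Mbar M x) n) : x • delQuot hx b = 0 := by
  exact (EX.push_smul_id x _).symm.trans (EX.push_f_del hx.smulShortComplex_shortExact b)

lemma exists_delQuot_of_smul_eq_zero (hx : IsSMulRegular M x) {A : ModuleCat.{0} R} (e : EX A M (n+1)) (h : x • e = 0) :
    ∃ b, delQuot hx b = e :=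
  EX.exact₁ hx.smulShortComplex_shortExact e ((EX.push_smul_id x e).trans h)

lemma exists_toQuot (hx : IsSMulRegular M x) {A : ModuleCat.{0} R} (b : EX A (Mbar M x) n) (h : delQuot hx b = 0) :
    ∃ a, toQuot x a = b := EX.exact₃ hx.smulShortComplex_shortExact b h

lemma delQuot_toQuot (hx : IsSMulRegular M x) {A : ModuleCat.{0} R} (a : EX A M n) : delQuot hx (toQuot x a) = 0 :=
  EX.del_push_g hx.smulShortComplex_shortExact a

lemma exists_smul_of_toQuot (hx : IsSMulRegular M x) {A : ModuleCat.{0} R} (a : EX A M n) (h : toQuot x a = 0) :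
    ∃ b, x • b = a := by
  obtain ⟨b, hb⟩ := EX.exact₂ hx.smulShortComplex_shortExact a h
  exact ⟨b, (EX.push_smul_id (N := M) x b).symm.trans hb⟩

section
variable {H : Type} [AddCommGroup H] [Module R H]
  {ι : ∀ t : ℕ, EX (ModuleCat.of R (R ⧸ J ^ t)) M n →ₗ[R] H}

lemma IsExtColim.eq_iff (hH : IsExtColim J M n H ι) {t s : ℕ} (a : EX (ModuleCat.of R (R ⧸ J ^ t)) M n) (b : EX (ModuleCat.of R (R ⧸ J ^ s)) M n)
    (h : ι t a = ι s b) : ∃ (u : ℕ) (h : t ≤ u) (h' : s ≤ u), _root_.res J h a = _root_.res J h' b := by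
  let m := max t s
  have h0 : ι m (_root_.res J (le_max_left t s) a - _root_.res J (le_max_right t s) b) = 0 := by
    rw [map_sub, hH.res, hH.res, h, sub_self]
  obtain ⟨u, hu, h1⟩ := hH.zero _ _ h0
  refine ⟨u, (le_max_left t s).trans hu, (le_max_right t s).trans hu, ?_⟩
  rw [res_sub, res_res, res_res, sub_eq_zero] at h1
  exact h1

lemma IsExtColim.smul_surjective (hH : IsExtColim J M n H ι) (hx : IsSMulRegular M x)
    (hv : ExtVanish J (ModuleCat.of R (QuotSMulTop x M)) n) (h : H) : ∃ h', x • h' = h := by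
  obtain ⟨t, e, rfl⟩ := hH.surj h
  obtain ⟨s, hs, h0⟩ := hv t (toQuot x e)
  obtain ⟨e', he'⟩ := exists_smul_of_toQuot hx _ ((res_toQuot hs e).symm.trans h0)
  refine ⟨ι s e', ?_⟩
  rw [← hH.res hs e, ← map_smul, ← he']

end

variable {H : Type} [AddCommGroup H] [Module R H]
  {ι : ∀ t : ℕ, EX (ModuleCat.of R (R ⧸ J ^ t)) M (n+1) →ₗ[R] H}

lemma IsExtColim.exists_delQuot (hH : IsExtColim J M (n+1) H ι) (hx : IsSMulRegular M x) (h : H) (h0 : x • h = 0) :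
    ∃ (t : ℕ) (b : EX (ModuleCat.of R (R ⧸ J ^ t)) (Mbar M x) n), ι t (delQuot hx b) = h := by
  obtain ⟨t, e, rfl⟩ := hH.surj h
  rw [← map_smul] at h0
  obtain ⟨s, hs, h1⟩ := hH.zero _ _ h0
  rw [res_smul] at h1
  obtain ⟨b, hb⟩ := exists_delQuot_of_smul_eq_zero hx _ h1
  exact ⟨s, b, by rw [← hH.res hs, hb]⟩

lemma IsExtColim.exists_smul_of_smul_eq_zero (hH : IsExtColim J M (n+1) H ι) (hx : IsSMulRegular M x)
    (hy : ∀ (t : ℕ) (b : EX (ModuleCat.of R (R ⧸ J ^ t)) (Mbar M x) n),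
      ∃ (s : ℕ) (h : t ≤ s) (b' : EX (ModuleCat.of R (R ⧸ J ^ s)) (Mbar M x) n), _root_.res J h b = y • b')
    (h : H) (h0 : x • h = 0) : ∃ h', x • h' = 0 ∧ y • h' = h := by
  obtain ⟨t, b, rfl⟩ := hH.exists_delQuot hx h h0
  obtain ⟨s, hs, b', hb'⟩ := hy t b
  refine ⟨ι s (delQuot hx b'), ?_, ?_⟩
  · rw [← map_smul, smul_delQuot, map_zero]
  · rw [← map_smul, ← map_smul, ← hb', ← res_delQuot, hH.res]

variable {A : Type} [AddCommGroup A] [Module R A]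
  {κ : ∀ t : ℕ, EX (ModuleCat.of R (R ⧸ J ^ t)) M n →ₗ[R] A}

/-- the submodule annihilated by `x` and `y` -/
noncomputable def tors₂ (H : Type) [AddCommGroup H] [Module R H] (x y : R) : Submodule R H :=
  LinearMap.ker (LinearMap.lsmul R H x) ⊓ LinearMap.ker (LinearMap.lsmul R H y)

lemma mem_tors₂ {h : H} : h ∈ tors₂ H x y ↔ x • h = 0 ∧ y • h = 0 := Iff.rfl

lemma IsExtColim.smul_top_of_tors₂_le (hH : IsExtColim J M (n+1) H ι) (hA : IsExtColim J M n A κ) (hx : IsSMulRegular M x)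
    (hy : ∀ (t : ℕ) (b : EX (ModuleCat.of R (R ⧸ J ^ t)) (Mbar M x) n),
      ∃ (s : ℕ) (h : t ≤ s) (b' : EX (ModuleCat.of R (R ⧸ J ^ s)) (Mbar M x) n), _root_.res J h b = y • b')
    {p : Ideal R} (hxp : x ∈ p) (hyp : y ∈ p) (hQ : tors₂ H x y ≤ p • tors₂ H x y) :
    (p • ⊤ : Submodule R A) = ⊤ := by
  have Φ : ∀ h ∈ p • tors₂ H x y, ∃ (s : ℕ) (b : EX (ModuleCat.of R (R ⧸ J ^ s)) (Mbar M x) n)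
      (a : EX (ModuleCat.of R (R ⧸ J ^ s)) M n), ι s (delQuot hx b) = h ∧ y • b = toQuot x a ∧
        κ s a ∈ (p • ⊤ : Submodule R A) := by
    intro h hh
    induction hh using Submodule.smul_induction_on' with
    | smul r hr q hq =>
      obtain ⟨hq1, hq2⟩ := mem_tors₂.1 hq
      obtain ⟨t, b, rfl⟩ := hH.exists_delQuot hx q hq1
      rw [← map_smul, ← map_smul] at hq2
      obtain ⟨s, hs, h1⟩ := hH.zero _ _ hq2
      rw [res_delQuot, res_smul] at h1
      obtain ⟨a, ha⟩ := exists_toQuot hx _ h1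
      refine ⟨s, r • _root_.res J hs b, r • a, ?_, ?_, ?_⟩
      · rw [map_smul, map_smul, ← res_delQuot, hH.res]
      · rw [map_smul, ha, smul_comm]
      · rw [map_smul]
        exact Submodule.smul_mem_smul hr trivial
    | add h₁ _ h₂ _ H₁ H₂ =>
      obtain ⟨s₁, b₁, a₁, e₁, f₁, g₁⟩ := H₁
      obtain ⟨s₂, b₂, a₂, e₂, f₂, g₂⟩ := H₂
      refine ⟨max s₁ s₂, _root_.res J (le_max_left _ _) b₁ + _root_.res J (le_max_right _ _) b₂,
        _root_.res J (le_max_left _ _) a₁ + _root_.res J (le_max_right _ _) a₂, ?_, ?_, ?_⟩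
      · rw [map_add, map_add, ← res_delQuot, hH.res, ← res_delQuot, hH.res, e₁, e₂]
      · rw [smul_add, map_add, ← res_smul, ← res_smul, f₁, f₂, res_toQuot, res_toQuot]
      · rw [map_add, hA.res, hA.res]
        exact add_mem g₁ g₂
  rw [eq_top_iff]
  rintro a -
  obtain ⟨t, α, rfl⟩ := hA.surj a
  obtain ⟨s, hs, b, hb⟩ := hy t (toQuot x α)
  rw [res_toQuot] at hb
  have hmem : ι s (delQuot hx b) ∈ tors₂ H x y := by
    refine mem_tors₂.2 ⟨?_, ?_⟩
    · rw [← map_smul, smul_delQuot, map_zero]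
    · rw [← map_smul, ← map_smul, ← hb, delQuot_toQuot, map_zero]
  obtain ⟨s', b', α', h1, h2, h3⟩ := Φ _ (hQ hmem)
  obtain ⟨u, hu, hu', h4⟩ := hH.eq_iff _ _ h1
  rw [res_delQuot, res_delQuot, ← sub_eq_zero, ← map_sub] at h4
  obtain ⟨β, hβ⟩ := exists_toQuot hx _ h4
  have h5 : toQuot x (_root_.res J hu α' - _root_.res J hu' (_root_.res J hs α) - y • β) = 0 := by
    rw [map_sub, map_sub, map_smul, hβ, ← res_toQuot, ← res_toQuot, ← h2, ← res_toQuot]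
    rw [← res_toQuot] at hb
    rw [res_toQuot, ← res_toQuot hs, hb, res_smul, res_smul, smul_sub, sub_self]
  obtain ⟨γ, hγ⟩ := exists_smul_of_toQuot hx _ h5
  have h6 : κ t α = κ s' α' - y • κ u β - x • κ u γ := by
    have h7 := congrArg (κ u) hγ
    rw [map_smul, map_sub, map_sub, map_smul, hA.res, hA.res, hA.res] at h7
    rw [h7]
    abel
  rw [h6]
  exact sub_mem (sub_mem h3 (Submodule.smul_mem_smul hyp trivial)) (Submodule.smul_mem_smul hxp trivial)

end divisible

section grade
open RingTheory.Sequence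
variable {S : Type} [CommRing S] {I : Ideal S}

lemma EX.eq_zero_of_isWeaklyRegular (rs : List S) (hI : ∀ r ∈ rs, r ∈ I) (W : ModuleCat.{0} S)
    (h : IsWeaklyRegular W rs) (i : ℕ) (hi : i < rs.length) (e : EX (ModuleCat.of S (S ⧸ I)) W i) : e = 0 := by
  induction rs generalizing W i with
  | nil => simp at hi
  | cons r rs ih =>
    rw [isWeaklyRegular_cons_iff] at h
    have hr : r • e = 0 := EX.smul_eq_zero_of_left (fun a => by
        obtain ⟨a, rfl⟩ := Ideal.Quotient.mk_surjective a
        show r • Ideal.Quotient.mk _ a = 0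
        rw [Algebra.smul_def, Ideal.Quotient.algebraMap_eq, ← map_mul, Ideal.Quotient.eq_zero_iff_mem]
        exact Ideal.mul_mem_right _ _ (hI r (by simp))) e
    rcases i with _ | i
    · have := EX.push_f_injective (A := ModuleCat.of S (S ⧸ I)) (h.1.smulShortComplex_shortExact)
      apply this
      refine Eq.trans ?_ (map_zero _).symm
      exact (EX.push_smul_id r e).trans hr
    · obtain ⟨e', rfl⟩ := exists_delQuot_of_smul_eq_zero h.1 e hr
      rw [ih (fun r hr => hI r (by simp [hr])) (Mbar W r) h.2 i (by simpa using hi) e', map_zero]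

lemma EX.exists_ne_zero_two {W : ModuleCat.{0} S} {x y : S} (hx : x ∈ I) (hy : y ∈ I) (hxr : IsSMulRegular W x)
    (hyr : IsSMulRegular (QuotSMulTop x W) y) (g : QuotSMulTop y (QuotSMulTop x W)) (hg : g ≠ 0)
    (hIg : ∀ r ∈ I, r • g = 0) : ∃ e : EX (ModuleCat.of S (S ⧸ I)) W 2, e ≠ 0 := by
  let φ : ModuleCat.of S (S ⧸ I) ⟶ Mbar (Mbar W x) y :=
    ModuleCat.ofHom (Submodule.liftQ I (LinearMap.toSpanSingleton S _ g) (fun r hr => hIg r hr))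
  have hφ : φ ≠ 0 := fun h0 => hg (by
    have : φ.hom (Submodule.Quotient.mk 1) = 0 := by rw [h0]; rfl
    rw [← one_smul S g]
    exact this)
  refine ⟨delQuot hxr (delQuot (M := Mbar W x) hyr (Abelian.Ext.mk₀ φ)), fun h0 => ?_⟩
  obtain ⟨a, ha⟩ := exists_toQuot hxr _ h0
  rw [EX.eq_zero_of_isWeaklyRegular (I := I) [x, y] (by simp [hx, hy]) W (by simp [isWeaklyRegular_cons_iff, hxr, hyr]) 1 (by simp) a,
    map_zero] at ha
  obtain ⟨b, hb⟩ := exists_toQuot (M := Mbar W x) hyr _ ha.symm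
  rw [EX.eq_zero_of_isWeaklyRegular (I := I) [y] (by simp [hy]) (Mbar W x) (by simpa [isWeaklyRegular_cons_iff] using hyr) 0 (by simp) b,
    map_zero] at hb
  exact hφ (EX.mk₀_inj (hb.symm.trans (Abelian.Ext.mk₀_zero _ _).symm))

lemma length_le_two_of_isRegular {W : ModuleCat.{0} S} {x y : S} (hx : x ∈ I) (hy : y ∈ I) (hxr : IsSMulRegular W x)
    (hyr : IsSMulRegular (QuotSMulTop x W) y) (g : QuotSMulTop y (QuotSMulTop x W)) (hg : g ≠ 0)
    (hIg : ∀ r ∈ I, r • g = 0) (rs : List S) (hrs : ∀ r ∈ rs, r ∈ I) (h : IsWeaklyRegular W rs) : rs.length ≤ 2 := by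
  by_contra! hlt
  obtain ⟨e, he⟩ := EX.exists_ne_zero_two hx hy hxr hyr g hg hIg
  exact he (EX.eq_zero_of_isWeaklyRegular rs hrs W h 2 hlt e)

lemma isRegular_pair {W : Type} [AddCommGroup W] [Module S W] {x y : S} (hxr : IsSMulRegular W x)
    (hyr : IsSMulRegular (QuotSMulTop x W) y) (g : QuotSMulTop y (QuotSMulTop x W)) (hg : g ≠ 0) :
    IsRegular W [x, y] := by
  have : Nontrivial (QuotSMulTop y (QuotSMulTop x W)) := ⟨g, 0, hg⟩
  rw [isRegular_cons_iff, isRegular_cons_iff]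
  exact ⟨hxr, hyr, IsRegular.nil _ _⟩

end grade

section duality
variable {S : Type} [CommRing S] {E : Type} [AddCommGroup E] [Module S E]

/-- `E` detects nonzero elements -/
def Cogenerates (S : Type) [CommRing S] (E : Type) [AddCommGroup E] [Module S E] : Prop :=
  ∀ (W : Type) [AddCommGroup W] [Module S W] (w : W), w ≠ 0 → ∃ h : W →ₗ[S] E, h w ≠ 0

lemma cogenerates_of_injective [IsLocalRing S] (hE : Module.Injective S E)
    (f : (S ⧸ IsLocalRing.maximalIdeal S) →ₗ[S] E) (hf : Function.Injective f) : Cogenerates S E := by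
  intro W _ _ w hw
  let K := LinearMap.ker (LinearMap.toSpanSingleton S W w)
  have hK : K ≠ ⊤ := fun h => hw (by
    have : (1 : S) ∈ K := h ▸ trivial
    simpa [K] using this)
  have hKm : K ≤ IsLocalRing.maximalIdeal S := IsLocalRing.le_maximalIdeal hK
  let a : (S ⧸ K) →ₗ[S] W := Submodule.liftQ K (LinearMap.toSpanSingleton S W w) le_rfl
  have ha : Function.Injective a := LinearMap.ker_eq_bot.1 (Submodule.ker_liftQ_eq_bot _ _ _ le_rfl)
  let b : (S ⧸ K) →ₗ[S] E := f ∘ₗ Submodule.mapQ K (IsLocalRing.maximalIdeal S) LinearMap.id hKm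
  obtain ⟨h, hh⟩ := Module.Injective.extension_property S _ _ _ a ha b
  refine ⟨h, fun h0 => ?_⟩
  have h1 : a (Submodule.Quotient.mk 1) = w := (Submodule.liftQ_apply K (LinearMap.toSpanSingleton S W w) (1 : S)).trans (one_smul S w)
  have h2 := LinearMap.congr_fun hh (Submodule.Quotient.mk 1)
  rw [LinearMap.comp_apply, h1, h0] at h2
  have h3 : f (Submodule.Quotient.mk (1 : S)) = 0 := h2.symm
  rw [map_eq_zero_iff f hf, Submodule.Quotient.mk_eq_zero] at h3
  exact (Ideal.ne_top_iff_one _).1 (Ideal.IsPrime.ne_top inferInstance) h3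

variable {W : Type} [AddCommGroup W] [Module S W] {x y : S}

lemma isSMulRegular_of_dual (hE : Cogenerates S E) (h : ∀ h : W →ₗ[S] E, ∃ h', x • h' = h) : IsSMulRegular W x := by
  refine IsSMulRegular.of_right_eq_zero_of_smul fun w hw => ?_
  by_contra h0
  obtain ⟨k, hk⟩ := hE W w h0
  obtain ⟨k', rfl⟩ := h k
  apply hk
  rw [LinearMap.smul_apply, ← map_smul, hw, map_zero]

/-- functionals killed by `x` factor through `W / x W` -/
lemma exists_factor_quotSMulTop (h : W →ₗ[S] E) (hx : x • h = 0) :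
    ∃ k : QuotSMulTop x W →ₗ[S] E, k ∘ₗ (x • ⊤ : Submodule S W).mkQ = h := by
  refine ⟨Submodule.liftQ _ h ?_, Submodule.liftQ_mkQ _ _ _⟩
  rintro _ ⟨w, -, rfl⟩
  have := LinearMap.congr_fun hx w
  simpa using this

lemma smul_comp_mkQ (k : QuotSMulTop x W →ₗ[S] E) : x • (k ∘ₗ (x • ⊤ : Submodule S W).mkQ) = 0 := by
  ext w
  rw [LinearMap.smul_apply, ← map_smul, LinearMap.comp_apply, LinearMap.zero_apply, Submodule.mkQ_apply,
    (Submodule.Quotient.mk_eq_zero _).2 (Submodule.smul_mem_pointwise_smul w x ⊤ trivial), map_zero]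

lemma isSMulRegular_quot_of_dual (hE : Cogenerates S E)
    (h : ∀ h : W →ₗ[S] E, x • h = 0 → ∃ h', x • h' = 0 ∧ y • h' = h) : IsSMulRegular (QuotSMulTop x W) y := by
  apply isSMulRegular_of_dual hE
  intro k
  obtain ⟨h', h1, h2⟩ := h _ (smul_comp_mkQ k)
  obtain ⟨k', rfl⟩ := exists_factor_quotSMulTop h' h1
  refine ⟨k', ?_⟩
  apply Submodule.linearMap_qext
  rw [LinearMap.smul_comp, h2]

lemma exists_sum_smul_of_no_socle {n : ℕ} (a : Fin n → S) (hE : Module.Injective S E)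
    (h0 : ∀ w : W, (∀ i, a i • w = 0) → w = 0) (h : W →ₗ[S] E) :
    ∃ c : Fin n → (W →ₗ[S] E), h = ∑ i, a i • c i := by
  let φ : W →ₗ[S] (Fin n → W) := LinearMap.pi fun i => LinearMap.lsmul S W (a i)
  have hφ : Function.Injective φ := by
    rw [← LinearMap.ker_eq_bot, LinearMap.ker_eq_bot']
    intro w hw
    exact h0 w (fun i => congrFun hw i)
  obtain ⟨k, hk⟩ := Module.Injective.extension_property S _ _ _ φ hφ h
  refine ⟨fun i => k ∘ₗ LinearMap.single S (fun _ => W) i, ?_⟩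
  ext w
  rw [← hk, LinearMap.comp_apply, ← Finset.univ_sum_single (φ w), map_sum, LinearMap.sum_apply]
  refine Finset.sum_congr rfl fun i _ => ?_
  rw [LinearMap.smul_apply, ← map_smul]
  rfl

lemma exists_sum_smul_of_dual {n : ℕ} (a : Fin n → S) (hE : Module.Injective S E)
    (h0 : ∀ g : QuotSMulTop y (QuotSMulTop x W), (∀ i, a i • g = 0) → g = 0) (h : W →ₗ[S] E) (hx : x • h = 0) (hy : y • h = 0) :
    ∃ c : Fin n → (W →ₗ[S] E), (∀ i, x • c i = 0 ∧ y • c i = 0) ∧ h = ∑ i, a i • c i := by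
  obtain ⟨k, rfl⟩ := exists_factor_quotSMulTop h hx
  have hyk : y • k = 0 := by
    apply Submodule.linearMap_qext
    rw [LinearMap.smul_comp, hy, LinearMap.zero_comp]
  obtain ⟨l, rfl⟩ := exists_factor_quotSMulTop k hyk
  obtain ⟨c, hc⟩ := exists_sum_smul_of_no_socle a hE h0 l
  refine ⟨fun i => (c i ∘ₗ Submodule.mkQ _) ∘ₗ Submodule.mkQ _, fun i => ⟨smul_comp_mkQ _, ?_⟩, ?_⟩
  · rw [← LinearMap.smul_comp, smul_comp_mkQ, LinearMap.zero_comp]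
  · rw [hc]
    ext w
    simp

end duality

section params
variable {R : Type} [CommRing R] [IsNoetherianRing R] {M : Type} [AddCommGroup M] [Module R M]
  [Module.Finite R M]

lemma supportDim_localized_le_one (p : PrimeSpectrum R) {x : R} (hx : x ∈ p.asIdeal)
    (hp : p.asIdeal ∈ (Module.annihilator R (QuotSMulTop x M)).minimalPrimes) :
    Module.supportDim (Localization.AtPrime p.asIdeal) (LocalizedModule p.asIdeal.primeCompl M) ≤ 1 := by
  let Rp := Localization.AtPrime p.asIdeal
  let Mp := LocalizedModule p.asIdeal.primeCompl M
  let x' : Rp := algebraMap R Rp x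
  have : Module.Finite Rp Mp := inferInstance
  have hx' : x' ∈ IsLocalRing.maximalIdeal Rp :=
    (IsLocalization.AtPrime.to_map_mem_maximal_iff Rp p.asIdeal x).2 hx
  have hann : ∀ r ∈ Module.annihilator R (QuotSMulTop x M),
      algebraMap R Rp r ∈ Module.annihilator Rp (QuotSMulTop x' Mp) := by
    intro r hr
    rw [Module.mem_annihilator]
    intro z
    obtain ⟨z, rfl⟩ := Submodule.Quotient.mk_surjective _ z
    rw [← Submodule.Quotient.mk_smul, Submodule.Quotient.mk_eq_zero]
    induction z using LocalizedModule.induction_on with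
    | h m s =>
    have h1 : r • m ∈ (x • ⊤ : Submodule R M) := by
      have := Module.mem_annihilator.1 hr (Submodule.Quotient.mk m)
      rwa [← Submodule.Quotient.mk_smul, Submodule.Quotient.mk_eq_zero] at this
    obtain ⟨m', -, hm'⟩ := h1
    have hm' : x • m' = r • m := hm'
    have : algebraMap R Rp r • LocalizedModule.mk m s = x' • LocalizedModule.mk m' s := by
      rw [algebraMap_smul, algebraMap_smul, LocalizedModule.smul'_mk, LocalizedModule.smul'_mk, hm']
    rw [this]
    exact Submodule.smul_mem_pointwise_smul _ _ _ trivial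
  have hsub : Subsingleton (Module.support Rp (QuotSMulTop x' Mp)) := by
    have key : ∀ q ∈ Module.support Rp (QuotSMulTop x' Mp), q.asIdeal = IsLocalRing.maximalIdeal Rp := by
      intro q hq
      have h1 : Module.annihilator R (QuotSMulTop x M) ≤ q.asIdeal.comap (algebraMap R Rp) := fun r hr =>
        Module.mem_support_iff_of_finite.1 hq (hann r hr)
      have h2 : q.asIdeal.comap (algebraMap R Rp) ≤ p.asIdeal := fun r hr =>
        (IsLocalization.AtPrime.to_map_mem_maximal_iff Rp p.asIdeal r).1
          (IsLocalRing.le_maximalIdeal q.2.ne_top hr)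
      have h3 := hp.2 ⟨q.2.comap _, h1⟩ h2
      refine le_antisymm (IsLocalRing.le_maximalIdeal q.2.ne_top) fun z hz => ?_
      obtain ⟨⟨r, s⟩, rs⟩ := IsLocalization.surj p.asIdeal.primeCompl z
      have h4 : algebraMap R Rp r ∈ IsLocalRing.maximalIdeal Rp := by
        rw [← rs]; exact Ideal.mul_mem_right _ _ hz
      have h5 : algebraMap R Rp r ∈ q.asIdeal :=
        h3 ((IsLocalization.AtPrime.to_map_mem_maximal_iff Rp p.asIdeal r).1 h4)
      rw [← rs] at h5
      refine (q.2.mem_or_mem h5).resolve_right fun h6 => q.2.ne_top ?_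
      exact Ideal.eq_top_of_isUnit_mem _ h6 (IsLocalization.map_units Rp s)
    exact ⟨fun a b => Subtype.ext (PrimeSpectrum.ext ((key a.1 a.2).trans (key b.1 b.2).symm))⟩
  have h0 : Module.supportDim Rp (QuotSMulTop x' Mp) ≤ 0 := Order.krullDim_nonpos_of_subsingleton
  refine (Module.supportDim_le_supportDim_quotSMulTop_succ hx').trans ?_
  calc _ ≤ (0 : WithBot ℕ∞) + 1 := by gcongr
    _ = 1 := zero_add 1

lemma exists_notMem_minimalPrimes (p : PrimeSpectrum R) (hp : p ∈ Module.support R M) {x : R} (hx : x ∈ p.asIdeal)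
    (hd : ¬ Module.supportDim (Localization.AtPrime p.asIdeal) (LocalizedModule p.asIdeal.primeCompl M) ≤ 1) :
    ∃ y ∈ p.asIdeal, ∀ q ∈ (Module.annihilator R (QuotSMulTop x M)).minimalPrimes, y ∉ q := by
  by_contra! h
  apply hd
  apply supportDim_localized_le_one p hx
  have hf := Ideal.finite_minimalPrimes_of_isNoetherianRing R (Module.annihilator R (QuotSMulTop x M))
  obtain ⟨q, hq, hpq⟩ := (Ideal.subset_union_prime (s := hf.toFinset) (f := id) ⊥ ⊥
    (fun q hq _ _ => (hf.mem_toFinset.1 hq).1.1) (I := p.asIdeal)).1 (fun y hy => by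
      obtain ⟨q, hq, hyq⟩ := h y hy
      simp only [Set.mem_iUnion]
      exact ⟨q, by simpa using hq, hyq⟩)
  have hq := hf.mem_toFinset.1 hq
  have hps : p ∈ Module.support R (QuotSMulTop x M) := by
    rw [Module.support_quotSMulTop]
    exact ⟨hp, by simpa [PrimeSpectrum.mem_zeroLocus] using hx⟩
  have h1 := hq.2 ⟨p.2, Module.mem_support_iff_of_finite.1 hps⟩ hpq
  rwa [le_antisymm hpq h1]

lemma WithBot.le_of_add_one_le {a : WithBot ℕ∞} {n : ℕ} (h : a + 1 ≤ ((n + 1 : ℕ) : WithBot ℕ∞)) : a ≤ (n : ℕ) := by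
  induction a with
  | bot => exact bot_le
  | coe a =>
    have h : ((a + 1 : ℕ∞) : WithBot ℕ∞) ≤ ((n + 1 : ℕ∞) : WithBot ℕ∞) := by exact_mod_cast h
    rw [WithBot.coe_le_coe] at h
    have : a ≤ (n : ℕ∞) := (ENat.add_le_add_iff_right (by simp)).1 h
    exact_mod_cast this

lemma WithBot.eq_bot_of_add_one_le_zero {a : WithBot ℕ∞} (h : a + 1 ≤ 0) : a = ⊥ := by
  induction a with
  | bot => rfl
  | coe a =>
    have h : ((a + 1 : ℕ∞) : WithBot ℕ∞) ≤ ((0 : ℕ∞) : WithBot ℕ∞) := h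
    rw [WithBot.coe_le_coe] at h
    simp at h

/-- choice of a pair of parameters -/
lemma exists_params [IsLocalRing R] (d : ℕ) (hdim : Module.supportDim R M = (d : ℕ)) (p : PrimeSpectrum R) (hp : p ∈ Module.support R M)
    (hd : ¬ Module.supportDim (Localization.AtPrime p.asIdeal) (LocalizedModule p.asIdeal.primeCompl M) ≤ 1)
    {x : R} (hx : x ∈ p.asIdeal) (hxr : IsSMulRegular M x) :
    ∃ n, d = n + 2 ∧ ∃ y ∈ p.asIdeal, Module.supportDim R (QuotSMulTop x M) ≤ (n + 1 : ℕ) ∧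
      Module.supportDim R (QuotSMulTop y (QuotSMulTop x M)) ≤ (n : ℕ) := by
  obtain ⟨y, hy, hyq⟩ := exists_notMem_minimalPrimes p hp hx hd
  have hm : p.asIdeal ≤ IsLocalRing.maximalIdeal R := IsLocalRing.le_maximalIdeal p.2.ne_top
  have h1 := Module.supportDim_quotSMulTop_succ_eq_supportDim hxr (hm hx)
  have h2 := Module.supportDim_quotSMulTop_succ_le_of_notMem_minimalPrimes hyq
  have : Nontrivial M := Module.nonempty_support_iff.1 ⟨p, hp⟩
  have : Nontrivial (QuotSMulTop x M) := nontrivial_quotSMulTop_of_mem_maximalIdeal M (hm hx)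
  have : Nontrivial (QuotSMulTop y (QuotSMulTop x M)) := nontrivial_quotSMulTop_of_mem_maximalIdeal _ (hm hy)
  have h3 : Module.supportDim R (QuotSMulTop y (QuotSMulTop x M)) ≠ ⊥ := Module.supportDim_ne_bot_of_nontrivial _ _
  rw [hdim] at h1
  rcases d with _ | _ | n
  · exact absurd (WithBot.eq_bot_of_add_one_le_zero h1.le) (Module.supportDim_ne_bot_of_nontrivial _ _)
  · exact absurd (WithBot.eq_bot_of_add_one_le_zero (h2.trans (WithBot.le_of_add_one_le h1.le))) h3
  · refine ⟨n, rfl, y, hy, ?_, ?_⟩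
    · exact WithBot.le_of_add_one_le h1.le
    · exact WithBot.le_of_add_one_le (h2.trans (WithBot.le_of_add_one_le h1.le))

end params

lemma eq_top_of_dual_sum {R S : Type} [CommRing R] [CommRing S] [Algebra R S]
    {J : Ideal R} {M : ModuleCat.{0} R} {x y : R} {n : ℕ}
    {W E H A : Type} [AddCommGroup W] [Module S W] [AddCommGroup E] [Module S E]
    [AddCommGroup H] [Module S H] [Module R H] (hRS : ∀ (r : R) (h : H), r • h = algebraMap R S r • h)
    [AddCommGroup A] [Module R A] (e : (W →ₗ[S] E) ≃ₗ[S] H)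
    {ι : ∀ t : ℕ, EX (ModuleCat.of R (R ⧸ J ^ t)) M (n+1) →ₗ[R] H}
    {κ : ∀ t : ℕ, EX (ModuleCat.of R (R ⧸ J ^ t)) M n →ₗ[R] A}
    (hH : IsExtColim J M (n+1) H ι) (hA : IsExtColim J M n A κ) (hx : IsSMulRegular M x)
    (hy : ∀ (t : ℕ) (b : EX (ModuleCat.of R (R ⧸ J ^ t)) (Mbar M x) n),
      ∃ (s : ℕ) (h : t ≤ s) (b' : EX (ModuleCat.of R (R ⧸ J ^ s)) (Mbar M x) n), res J h b = y • b')
    {p : Ideal R} (hxp : x ∈ p) (hyp : y ∈ p) {k : ℕ} (a : Fin k → R) (hap : ∀ i, a i ∈ p)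
    (hc : ∀ h : W →ₗ[S] E, algebraMap R S x • h = 0 → algebraMap R S y • h = 0 →
      ∃ c : Fin k → (W →ₗ[S] E), (∀ i, algebraMap R S x • c i = 0 ∧ algebraMap R S y • c i = 0) ∧
        h = ∑ i, algebraMap R S (a i) • c i) :
    (p • ⊤ : Submodule R A) = ⊤ := by
  refine hH.smul_top_of_tors₂_le hA hx hy hxp hyp fun h hh => ?_
  obtain ⟨h1, h2⟩ := mem_tors₂.1 hh
  obtain ⟨c, hc1, hc2⟩ := hc (e.symm h) (by rw [← map_smul, ← hRS, h1, map_zero])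
    (by rw [← map_smul, ← hRS, h2, map_zero])
  rw [LinearEquiv.symm_apply_eq, map_sum] at hc2
  rw [hc2]
  refine Submodule.sum_mem _ fun i _ => ?_
  rw [map_smul, ← hRS]
  refine Submodule.smul_mem_smul (hap i) (mem_tors₂.2 ⟨?_, ?_⟩)
  · rw [hRS, ← map_smul, (hc1 i).1, map_zero]
  · rw [hRS, ← map_smul, (hc1 i).2, map_zero]

lemma not_smul_top_eq_top_of_eq_annihilator {R A : Type} [CommRing R] [AddCommGroup A] [Module R A] {p : Ideal R}
    (hp : p ≠ ⊤) (N : Submodule R A) (h : p = Module.annihilator R (A ⧸ N)) : (p • ⊤ : Submodule R A) ≠ ⊤ := by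
  intro h0
  apply hp
  have hN : N = ⊤ := by
    rw [eq_top_iff, ← h0, Submodule.smul_le]
    intro r hr a _
    rw [h, Module.mem_annihilator] at hr
    exact (Submodule.Quotient.mk_eq_zero N).1 (hr (Submodule.Quotient.mk a))
  obtain ⟨hu⟩ := Submodule.unique_quotient_iff_eq_top.2 hN
  rw [h, Module.annihilator_eq_top_iff]
  infer_instance

theorem stmt5 (R : Type) [CommRing R] [IsNoetherianRing R] [IsLocalRing R]
    (d' : ℕ) (M : ModuleCat R) (hM : Module.Finite R ↥M)
    (hdim : mdim R ↥M = (d' : WithBot ℕ∞))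
    (p : PrimeSpectrum R) (hp : p ∈ Module.support R ↥M)
    (hht : (3 : WithBot ℕ∞) ≤ htM R ↥M p)
    (hreg : ¬ ((p.asIdeal : Set R) ⊆ {r : R | ¬ IsSMulRegular (↥M) r}))
    (hcan : ∃ ω : ModuleCat R, IsCanonicalModule R (maximalIdeal R) d' M ω)
    (hatt : p.asIdeal ∈ attachedPrimes R ↥(LC R (maximalIdeal R) (d' - 1) M)) :
    ∀ ω' : ModuleCat (AdicCompletion (maximalIdeal R) R),
      IsCanonicalModule (AdicCompletion (maximalIdeal R) R)
        ((maximalIdeal R).map (algebraMap R (AdicCompletion (maximalIdeal R) R))) d'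
        (ModuleCat.of (AdicCompletion (maximalIdeal R) R)
          (AdicCompletion (maximalIdeal R) ↥M)) ω' →
      gradeI (AdicCompletion (maximalIdeal R) R)
        (p.asIdeal.map (algebraMap R (AdicCompletion (maximalIdeal R) R))) ↥ω' = 2 := by
  obtain ⟨x, hxp, hxr⟩ := Set.not_subset.1 hreg
  replace hxr : IsSMulRegular M x := not_not.1 hxr
  have hd : ¬ Module.supportDim (Localization.AtPrime p.asIdeal)
      (LocalizedModule p.asIdeal.primeCompl M) ≤ 1 := fun h =>
    absurd (hht.trans h) (by decide)
  obtain ⟨n, rfl, y, hyp, hdx, hdy⟩ := exists_params d' hdim p hp hd hxp hxr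
  rintro ω' ⟨hfin, E, ⟨hEinj, f, hf, -⟩, ⟨e⟩⟩
  obtain ⟨-, N, hN⟩ := hatt
  let S := AdicCompletion (maximalIdeal R) R
  let H := (localCohomology ((maximalIdeal R).map (algebraMap R S)) (n+2)).obj
    (ModuleCat.of S (AdicCompletion (maximalIdeal R) M))
  let e' : (ω' →ₗ[S] E) ≃ₗ[S] H := e
  let : Module R H := Module.compHom H (algebraMap R S)
  have hRS : ∀ (r : R) (h : H), r • h = algebraMap R S r • h := fun _ _ => rfl
  obtain ⟨ι, hH⟩ := isExtColim_completion M (n+1) hRS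
  obtain ⟨κ, hA⟩ := LC_isExtColim (maximalIdeal R) M n
  have v1 : ExtVanish (maximalIdeal R) (Mbar M x) (n+1+1) :=
    extVanish_of_supportDim_le (n+1) (QuotSMulTop x M) hdx
  have v2 : ExtVanish (maximalIdeal R) (ModuleCat.of R (QuotSMulTop y (Mbar M x))) (n+1) :=
    extVanish_of_supportDim_le n (QuotSMulTop y (QuotSMulTop x M)) hdy
  have v3 : ExtVanish (maximalIdeal R) (ModuleCat.of R (LinearMap.ker (mulOnto (Mbar M x) y).hom)) (n+1+1) :=
    extVanish_of_supportDim_le (n+1) _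
      ((Module.supportDim_le_of_injective _ (Submodule.subtype_injective _)).trans hdx)
  have hy := ExtVanish.exists_res_eq_smul v2 v3
  have hcog : Cogenerates S E := by
    obtain ⟨g, hg⟩ : ∃ g : (S ⧸ maximalIdeal S) →ₗ[S] E, Function.Injective g := by
      rw [AdicCompletion.maximalIdeal_eq_map]
      exact ⟨f, hf⟩
    exact cogenerates_of_injective hEinj g hg
  have hsurj : ∀ h : ω' →ₗ[S] E, ∃ h', algebraMap R S x • h' = h := fun h => by
    obtain ⟨h', h0⟩ := hH.smul_surjective hxr v1 (e' h)
    exact ⟨e'.symm h', by rw [← map_smul, ← hRS, h0, e'.symm_apply_apply]⟩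
  have hxω : IsSMulRegular ω' (algebraMap R S x) := isSMulRegular_of_dual hcog hsurj
  have hyω : IsSMulRegular (QuotSMulTop (algebraMap R S x) ω') (algebraMap R S y) := by
    refine isSMulRegular_quot_of_dual hcog fun h h0 => ?_
    obtain ⟨h', h1, h2⟩ := hH.exists_smul_of_smul_eq_zero hxr hy (e' h)
      (by rw [hRS, ← map_smul, h0, map_zero])
    exact ⟨e'.symm h', by rw [← map_smul, ← hRS, h1, map_zero],
      by rw [← map_smul, ← hRS, h2, e'.symm_apply_apply]⟩
  obtain ⟨k, a, ha⟩ := Submodule.fg_iff_exists_fin_generating_family.1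
    ((isNoetherianRing_iff_ideal_fg R).1 inferInstance p.asIdeal)
  have hap : ∀ i, a i ∈ p.asIdeal := fun i => ha ▸ Submodule.subset_span ⟨i, rfl⟩
  obtain ⟨g, hg, hg0⟩ : ∃ g : QuotSMulTop (algebraMap R S y) (QuotSMulTop (algebraMap R S x) ω'),
      (∀ i, algebraMap R S (a i) • g = 0) ∧ g ≠ 0 := by
    by_contra! h0
    exact not_smul_top_eq_top_of_eq_annihilator p.isPrime.ne_top N hN
      (eq_top_of_dual_sum hRS e' hH hA hxr hy hxp hyp a hap
        (exists_sum_smul_of_dual (fun i => algebraMap R S (a i)) hEinj h0))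
  have hpg : ∀ r ∈ p.asIdeal.map (algebraMap R S), r • g = 0 := by
    intro r hr
    rw [← ha, ← Ideal.span, Ideal.map_span] at hr
    induction hr using Submodule.span_induction with
    | mem r hr =>
      obtain ⟨-, ⟨i, rfl⟩, rfl⟩ := hr
      exact hg i
    | zero => exact zero_smul _ _
    | add r s _ _ hr hs => rw [add_smul, hr, hs, add_zero]
    | smul c r _ hr => rw [smul_eq_mul, mul_smul, hr, smul_zero]
  have hxI := Ideal.mem_map_of_mem (algebraMap R S) hxp
  have hyI := Ideal.mem_map_of_mem (algebraMap R S) hyp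
  refine le_antisymm (sSup_le ?_) (le_sSup ⟨[algebraMap R S x, algebraMap R S y], rfl, ?_, isRegular_pair hxω hyω g hg0⟩)
  · rintro _ ⟨rs, rfl, hrs, h⟩
    exact_mod_cast length_le_two_of_isRegular hxI hyI hxω hyω g hg0 hpg rs hrs h.toIsWeaklyRegular
  · simp only [List.mem_cons, List.not_mem_nil, or_false]
    rintro r (rfl | rfl)
    exacts [hxI, hyI]
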